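/- For every realizable uniform rank-3 chirotope χ on n ≥ 3 elements, there exists a neighborly polytope P of dimension 2n−4 with exactly 2n vertices such that the realization space ℛ(χ) is stably equivalent to the realization space ℛ(P). -/

import Mathlib

noncomputable section

/-- A primary basic semialgebraic set in `ℝ^m` defined over `ℤ`: the solution set of finitely
many polynomial equalities and *strict* polynomial inequalities with integer coefficients. -/
def IsPrimaryBasicSemialgebraicZ {m : ℕ} (S : Set (Fin m → ℝ)) : Prop :=
  ∃ (k l : ℕ) (f : Fin k → MvPolynomial (Fin m) ℤ) (g : Fin l → MvPolynomial (Fin m) ℤ),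
    S = {x : Fin m → ℝ |
      (∀ i, MvPolynomial.aeval x (f i) = (0 : ℝ)) ∧
      (∀ j, (0 : ℝ) < MvPolynomial.aeval x (g j))}

/-- `S ⊆ ℝ^d` is a stable projection of `T ⊆ ℝ^{d+d'}`: the coordinate projection maps `T`
onto `S`, and over each `x ∈ S` the fiber of `T` is a nonempty set given by linear equalities
and strict linear inequalities in the fiber variables, whose coefficients depend polynomially
on `x` (i.e. the relative interior of a nonempty polyhedron depending polynomially on `x`). -/
def IsStableProjection {d d' : ℕ} (S : Set (Fin d → ℝ)) (T : Set (Fin (d + d') → ℝ)) : Prop :=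
  ∃ (k l : ℕ) (A : Fin k → Fin d' → MvPolynomial (Fin d) ℝ) (b : Fin k → MvPolynomial (Fin d) ℝ)
    (C : Fin l → Fin d' → MvPolynomial (Fin d) ℝ) (c : Fin l → MvPolynomial (Fin d) ℝ),
    (∀ x ∈ S, ∃ y : Fin d' → ℝ, Fin.append x y ∈ T) ∧
    ∀ (x : Fin d → ℝ) (y : Fin d' → ℝ),
      Fin.append x y ∈ T ↔
        x ∈ S ∧
        (∀ i, (∑ j, MvPolynomial.eval x (A i j) * y j) + MvPolynomial.eval x (b i) = 0) ∧
        (∀ i, 0 < (∑ j, MvPolynomial.eval x (C i j) * y j) + MvPolynomial.eval x (c i))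

/-- `f` is coordinatewise a rational function on `S` (denominators nonvanishing on `S`). -/
def IsRationalMapOn {d e : ℕ} (S : Set (Fin d → ℝ)) (f : (Fin d → ℝ) → Fin e → ℝ) : Prop :=
  ∀ i : Fin e, ∃ p q : MvPolynomial (Fin d) ℝ, ∀ x ∈ S,
    MvPolynomial.eval x q ≠ 0 ∧ f x i = MvPolynomial.eval x p / MvPolynomial.eval x q

/-- `S` and `T` are rationally equivalent: there are mutually inverse bijections between them
which are coordinatewise rational (hence in particular a homeomorphism). -/
def RationallyEquivalent {d e : ℕ} (S : Set (Fin d → ℝ)) (T : Set (Fin e → ℝ)) : Prop :=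
  ∃ (f : (Fin d → ℝ) → Fin e → ℝ) (g : (Fin e → ℝ) → Fin d → ℝ),
    IsRationalMapOn S f ∧ IsRationalMapOn T g ∧
    (∀ x ∈ S, f x ∈ T) ∧ (∀ y ∈ T, g y ∈ S) ∧
    (∀ x ∈ S, g (f x) = x) ∧ (∀ y ∈ T, f (g y) = y)

/-- One generating step of stable equivalence: a stable projection (in either direction,
symmetry being supplied by the generated equivalence) or a rational equivalence. -/
def StableStep (X Y : Σ d : ℕ, Set (Fin d → ℝ)) : Prop :=
  (∃ (d' : ℕ) (T : Set (Fin (X.1 + d') → ℝ)),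
      Y = ⟨X.1 + d', T⟩ ∧ IsStableProjection X.2 T) ∨
  RationallyEquivalent X.2 Y.2

/-- Stable equivalence: the equivalence relation generated by stable projections and
rational equivalences. -/
def StablyEquivalent (X Y : Σ d : ℕ, Set (Fin d → ℝ)) : Prop :=
  Relation.EqvGen StableStep X Y

/-- The index of the `c`-th coordinate of the `p`-th point in the flattening
`(ℝ^d)^n ≃ ℝ^{d·n}`. -/
def flatIdx {n d : ℕ} (p : Fin n) (c : Fin d) : Fin (d * n) :=
  ⟨d * p.1 + c.1, by
    have h1 : d * (p.1 + 1) ≤ d * n := Nat.mul_le_mul le_rfl p.2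
    have h2 : d * (p.1 + 1) = d * p.1 + d := by ring
    have h3 := c.2
    omega⟩

/-- Flatten a set of point configurations `(ℝ^d)^n` into a subset of `ℝ^{d·n}`. -/
def flat {n d : ℕ} (R : Set (Fin n → Fin d → ℝ)) : Set (Fin (d * n) → ℝ) :=
  {x | (fun (p : Fin n) (c : Fin d) => x (flatIdx p c)) ∈ R}

/-- `v '' S` is the set of extreme points of some face of the polytope `conv (range v)`;
the faces of a polytope `Q` are `Q` itself, `∅`, and the exposed faces of `Q`
(`∅` is exposed). -/
def IsVertexSetOfFace {n d : ℕ} (v : Fin n → Fin d → ℝ) (S : Finset (Fin n)) : Prop :=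
  ∃ F : Set (Fin d → ℝ),
    (F = convexHull ℝ (Set.range v) ∨ IsExposed ℝ (convexHull ℝ (Set.range v)) F) ∧
    Set.extremePoints ℝ F = v '' ↑S

/-- `v` lists the `n` vertices of a (full-dimensional) polytope in `ℝ^d`: the `v i` are
pairwise distinct, each is an extreme point of their convex hull, and they affinely
span `ℝ^d` (so the polytope has dimension `d`). -/
def IsPolytopeVertexList {n d : ℕ} (v : Fin n → Fin d → ℝ) : Prop :=
  Function.Injective v ∧
  (∀ i, v i ∈ Set.extremePoints ℝ (convexHull ℝ (Set.range v))) ∧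
  affineSpan ℝ (Set.range v) = ⊤

/-- The (normalized) realization space of the polytope with vertex list `v`, with respect to
the affine basis indexed by `B`: labeled point configurations `x` fixing the basis, all of
whose points are vertices of their convex hull, with the same vertex sets of faces as `v`. -/
def polytopeRealizationSpace {n d : ℕ} (v : Fin n → Fin d → ℝ) (B : Finset (Fin n)) :
    Set (Fin n → Fin d → ℝ) :=
  {x | (∀ i ∈ B, x i = v i) ∧
    (∀ i, x i ∈ Set.extremePoints ℝ (convexHull ℝ (Set.range x))) ∧
    ∀ S : Finset (Fin n), IsVertexSetOfFace x S ↔ IsVertexSetOfFace v S}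

/-- A `d`-polytope with vertex list `v` is neighborly if every set of at most `⌊d/2⌋`
vertices is the vertex set of a face. -/
def IsNeighborly {n d : ℕ} (v : Fin n → Fin d → ℝ) : Prop :=
  ∀ S : Finset (Fin n), S.card ≤ d / 2 → IsVertexSetOfFace v S

/-- A polytope is simplicial if all of its proper faces are simplices. -/
def IsSimplicialVertexList {n d : ℕ} (v : Fin n → Fin d → ℝ) : Prop :=
  ∀ F : Set (Fin d → ℝ), IsExposed ℝ (convexHull ℝ (Set.range v)) F →
    F ≠ convexHull ℝ (Set.range v) →
    ∃ s : Finset (Fin d → ℝ),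
      AffineIndependent ℝ (fun x : ↥s => (x : Fin d → ℝ)) ∧ F = convexHull ℝ ↑s

/-- The determinant of three vectors in `ℝ³`. -/
def det3 (u v w : Fin 3 → ℝ) : ℝ :=
  u 0 * (v 1 * w 2 - v 2 * w 1) - u 1 * (v 0 * w 2 - v 2 * w 0) +
    u 2 * (v 0 * w 1 - v 1 * w 0)

/-- A map on triples is alternating: swapping two adjacent arguments changes the sign. -/
def IsAlternating3 {n : ℕ} (χ : Fin n → Fin n → Fin n → ℝ) : Prop :=
  ∀ i j k : Fin n, χ j i k = -χ i j k ∧ χ i k j = -χ i j k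

/-- `v` is a realization of the uniform chirotope `χ`: for all distinct `i, j, k`,
the sign of `det(v i, v j, v k)` is `χ i j k`. -/
def IsRealizationOfUniform {n : ℕ} (χ : Fin n → Fin n → Fin n → ℝ)
    (v : Fin n → Fin 3 → ℝ) : Prop :=
  ∀ i j k : Fin n, i ≠ j → i ≠ k → j ≠ k →
    Real.sign (det3 (v i) (v j) (v k)) = χ i j k

/-- A realizable uniform rank-3 chirotope on `n` elements. -/
def IsRealizableUniformChirotope {n : ℕ} (χ : Fin n → Fin n → Fin n → ℝ) : Prop :=
  IsAlternating3 χ ∧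
  (∀ i j k : Fin n, i ≠ j → i ≠ k → j ≠ k → χ i j k = 1 ∨ χ i j k = -1) ∧
  ∃ v, IsRealizationOfUniform χ v

/-- The normalized realization space of a uniform rank-3 chirotope `χ`
(normalized so that the first three vectors are the standard basis of `ℝ³`,
which presupposes `χ 1 2 3 = +1`). -/
def uniformChirotopeRealizationSpace {n : ℕ} (hn : 3 ≤ n)
    (χ : Fin n → Fin n → Fin n → ℝ) : Set (Fin n → Fin 3 → ℝ) :=
  {v | v ⟨0, by omega⟩ = ![1, 0, 0] ∧ v ⟨1, by omega⟩ = ![0, 1, 0] ∧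
       v ⟨2, by omega⟩ = ![0, 0, 1] ∧ IsRealizationOfUniform χ v}

section VectorConfigurations

open scoped Matrix

theorem det3_eq_cross (u v w : Fin 3 → ℝ) : det3 u v w = (u ⨯₃ v) ⬝ᵥ w := by
  simp only [det3, cross_apply, dotProduct, Fin.sum_univ_three, Matrix.cons_val]
  ring

theorem det3_rotate (u v w : Fin 3 → ℝ) : det3 u v w = det3 v w u := by
  simp only [det3]; ring

theorem det3_swap (u v w : Fin 3 → ℝ) : det3 u v w = -det3 v u w := by
  simp only [det3]; ring

theorem det3_self_left (u w : Fin 3 → ℝ) : det3 u u w = 0 := by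
  simp only [det3]; ring

theorem det3_self_right (u v : Fin 3 → ℝ) : det3 u v v = 0 := by
  simp only [det3]; ring

theorem det3_self_outer (u v : Fin 3 → ℝ) : det3 u v u = 0 := by
  simp only [det3]; ring

theorem det3_smul_smul_smul (a b c : ℝ) (u v w : Fin 3 → ℝ) :
    det3 (a • u) (b • v) (c • w) = a * b * c * det3 u v w := by
  simp only [det3, Pi.smul_apply, smul_eq_mul]; ring

theorem det3_smul_eq (a b c y : Fin 3 → ℝ) :
    det3 a b c • y =
      (y ⬝ᵥ c) • (a ⨯₃ b) + (y ⬝ᵥ a) • (b ⨯₃ c) + (y ⬝ᵥ b) • (c ⨯₃ a) := by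
  ext i
  fin_cases i <;>
    simp [det3, cross_apply, dotProduct, Fin.sum_univ_three] <;> ring

theorem eq_zero_of_dotProduct_eq_zero {a b c y : Fin 3 → ℝ} (h : det3 a b c ≠ 0)
    (ha : y ⬝ᵥ a = 0) (hb : y ⬝ᵥ b = 0) (hc : y ⬝ᵥ c = 0) : y = 0 := by
  have := det3_smul_eq a b c y
  simp only [ha, hb, hc, zero_smul, add_zero, smul_eq_zero] at this
  exact this.resolve_left h

theorem exists_smul_cross_eq {a b c y : Fin 3 → ℝ} (h : det3 a b c ≠ 0)
    (ha : y ⬝ᵥ a = 0) (hb : y ⬝ᵥ b = 0) : ∃ κ : ℝ, y = κ • (a ⨯₃ b) := by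
  refine ⟨(det3 a b c)⁻¹ * (y ⬝ᵥ c), ?_⟩
  have := det3_smul_eq a b c y
  simp only [ha, hb, zero_smul, add_zero] at this
  rw [mul_smul, ← this, smul_smul, inv_mul_cancel₀ h, one_smul]

theorem exists_normal_of_det3_eq_zero {a b c : Fin 3 → ℝ} (h : det3 a b c = 0) :
    ∃ y : Fin 3 → ℝ, y ≠ 0 ∧ y ⬝ᵥ a = 0 ∧ y ⬝ᵥ b = 0 ∧ y ⬝ᵥ c = 0 := by
  have hdet : (Matrix.of ![a, b, c]).det = 0 := by
    rw [← h, Matrix.det_fin_three]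
    simp [det3]
    ring
  obtain ⟨y, hy, hM⟩ := Matrix.exists_mulVec_eq_zero_iff.mpr hdet
  refine ⟨y, hy, ?_, ?_, ?_⟩
  · have := congrFun hM 0
    simpa [Matrix.mulVec, dotProduct_comm] using this
  · have := congrFun hM 1
    simpa [Matrix.mulVec, dotProduct_comm] using this
  · have := congrFun hM 2
    simpa [Matrix.mulVec, dotProduct_comm] using this

/-- Any three of the vectors `W` are linearly independent. -/
def IsUniformConfiguration {ι : Type*} (W : ι → Fin 3 → ℝ) : Prop :=
  ∀ i j k, i ≠ j → i ≠ k → j ≠ k → det3 (W i) (W j) (W k) ≠ 0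

theorem exists_slide {ι : Type*} {W : ι → Fin 3 → ℝ} {T : Finset ι} {y z : Fin 3 → ℝ}
    (hy : ∀ i ∈ T, 0 ≤ y ⬝ᵥ W i) {i : ι} (hi : i ∈ T) (hz : z ⬝ᵥ W i < 0) :
    ∃ t : ℝ, (∀ j ∈ T, 0 ≤ (y + t • z) ⬝ᵥ W j) ∧
      ∃ s ∈ T, z ⬝ᵥ W s < 0 ∧ (y + t • z) ⬝ᵥ W s = 0 := by
  have hne : (T.filter fun j => z ⬝ᵥ W j < 0).Nonempty := ⟨i, by simp [hi, hz]⟩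
  obtain ⟨s, hs, hmin⟩ := Finset.exists_min_image _
    (fun j => (y ⬝ᵥ W j) / (-(z ⬝ᵥ W j))) hne
  rw [Finset.mem_filter] at hs
  have ht : 0 ≤ (y ⬝ᵥ W s) / (-(z ⬝ᵥ W s)) :=
    div_nonneg (hy s hs.1) (by linarith [hs.2])
  refine ⟨(y ⬝ᵥ W s) / (-(z ⬝ᵥ W s)), fun j hj => ?_, s, hs.1, hs.2, ?_⟩
  · rw [add_dotProduct, smul_dotProduct, smul_eq_mul]
    rcases lt_or_ge (z ⬝ᵥ W j) 0 with hzj | hzj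
    · have := hmin j (by simp [hj, hzj])
      rw [le_div_iff₀ (by linarith)] at this
      linarith
    · have := hy j hj
      positivity
  · rw [add_dotProduct, smul_dotProduct, smul_eq_mul]
    have := hs.2.ne
    field_simp
    ring

theorem exists_neg_cross {ι : Type*} {W : ι → Fin 3 → ℝ} (hW : IsUniformConfiguration W) {a b i : ι}
    (hab : a ≠ b) (hai : a ≠ i) (hbi : b ≠ i) :
    ∃ z : Fin 3 → ℝ, z ⬝ᵥ W a = 0 ∧ z ⬝ᵥ W b = 0 ∧ z ⬝ᵥ W i < 0 := by
  have h := hW a b i hab hai hbi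
  refine ⟨(-det3 (W a) (W b) (W i)) • (W a ⨯₃ W b), ?_, ?_, ?_⟩
  · simp only [smul_dotProduct, ← det3_eq_cross, det3_self_outer, smul_zero]
  · simp only [smul_dotProduct, ← det3_eq_cross, det3_self_right, smul_zero]
  · simp only [smul_dotProduct, ← det3_eq_cross, smul_eq_mul]
    have := mul_self_pos.mpr h
    linarith

variable {ι : Type*} [Fintype ι]

/-- `T` is the support of a nonnegative linear dependency of the vectors `W`. -/
def HasPositiveDependency (W : ι → Fin 3 → ℝ) (T : Finset ι) : Prop :=
  ∃ c : ι → ℝ, (∀ i ∉ T, c i = 0) ∧ (∀ i ∈ T, 0 < c i) ∧ ∑ i, c i • W i = 0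

/-- The indices of the vectors on the negative side of the plane with normal vector `y`. -/
def negativeSide (W : ι → Fin 3 → ℝ) (y : Fin 3 → ℝ) : Finset ι :=
  Finset.univ.filter fun i => y ⬝ᵥ W i < 0

/-- Every open half-space contains at least `n - 1` of the vectors `W`. -/
def IsBalancedConfiguration (n : ℕ) (W : ι → Fin 3 → ℝ) : Prop :=
  ∀ y : Fin 3 → ℝ, y ≠ 0 → n ≤ (negativeSide W y).card + 1

theorem mem_negativeSide {W : ι → Fin 3 → ℝ} {y : Fin 3 → ℝ} {i : ι} :
    i ∈ negativeSide W y ↔ y ⬝ᵥ W i < 0 := by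
  simp [negativeSide]

theorem mem_negativeSide_neg {W : ι → Fin 3 → ℝ} {y : Fin 3 → ℝ} {i : ι} :
    i ∈ negativeSide W (-y) ↔ 0 < y ⬝ᵥ W i := by
  simp [negativeSide]

theorem disjoint_negativeSide_neg (W : ι → Fin 3 → ℝ) (y : Fin 3 → ℝ) :
    Disjoint (negativeSide W y) (negativeSide W (-y)) := by
  rw [Finset.disjoint_left]
  intro i h1 h2
  rw [mem_negativeSide] at h1
  rw [mem_negativeSide_neg] at h2
  linarith

theorem sum_mul_dotProduct_eq_zero {W : ι → Fin 3 → ℝ} {c : ι → ℝ} (h : ∑ i, c i • W i = 0)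
    (y : Fin 3 → ℝ) : ∑ i, c i * (y ⬝ᵥ W i) = 0 := by
  have := congrArg (fun v => y ⬝ᵥ v) h
  simpa [dotProduct_sum, dotProduct_smul] using this

theorem HasPositiveDependency.dotProduct_eq_zero {W : ι → Fin 3 → ℝ} {T : Finset ι}
    (h : HasPositiveDependency W T) {y : Fin 3 → ℝ} (hy : ∀ i ∈ T, 0 ≤ y ⬝ᵥ W i) :
    ∀ i ∈ T, y ⬝ᵥ W i = 0 := by
  obtain ⟨c, hc0, hc, hsum⟩ := h
  have hs := sum_mul_dotProduct_eq_zero hsum y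
  have hnn : ∀ i ∈ Finset.univ, 0 ≤ c i * (y ⬝ᵥ W i) := by
    intro i _
    by_cases hi : i ∈ T
    · exact mul_nonneg (hc i hi).le (hy i hi)
    · simp [hc0 i hi]
  intro i hi
  have := (Finset.sum_eq_zero_iff_of_nonneg hnn).mp hs i (Finset.mem_univ i)
  exact (mul_eq_zero.mp this).resolve_left (hc i hi).ne'

variable [DecidableEq ι]

theorem IsUniformConfiguration.exists_third {W : ι → Fin 3 → ℝ} (hW : IsUniformConfiguration W)
    (hcard : 3 ≤ Fintype.card ι) {a b : ι} (hab : a ≠ b) :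
    ∃ c, c ≠ a ∧ c ≠ b ∧ det3 (W a) (W b) (W c) ≠ 0 := by
  obtain ⟨c, hc⟩ : ∃ c, c ∉ ({a, b} : Finset ι) := by
    by_contra! h
    have : (Finset.univ : Finset ι).card ≤ ({a, b} : Finset ι).card :=
      Finset.card_le_card fun c _ => h c
    have h2 := Finset.card_le_two (a := a) (b := b)
    rw [Finset.card_univ] at this
    omega
  simp only [Finset.mem_insert, Finset.mem_singleton, not_or] at hc
  exact ⟨c, hc.1, hc.2, hW a b c hab (Ne.symm hc.1) (Ne.symm hc.2)⟩

/-- Stiemke's lemma for vectors in `ℝ³`. -/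
theorem exists_nonneg_of_not_hasPositiveDependency {W : ι → Fin 3 → ℝ}
    (hW : IsUniformConfiguration W) {T : Finset ι} (hT : 3 ≤ T.card)
    (h : ¬HasPositiveDependency W T) :
    ∃ y : Fin 3 → ℝ, (∀ i ∈ T, 0 ≤ y ⬝ᵥ W i) ∧ ∃ i ∈ T, 0 < y ⬝ᵥ W i := by
  obtain ⟨a, b, c, ha, hb, hc, hab, hac, hbc⟩ := Finset.two_lt_card_iff.mp hT
  have hD : det3 (W a) (W b) (W c) ≠ 0 := hW a b c hab hac hbc
  let L : (T → ℝ) →ₗ[ℝ] (Fin 3 → ℝ) := Fintype.linearCombination ℝ fun i : T => W i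
  have hL : ∀ g, L g = ∑ i : T, g i • W i := fun g => Fintype.linearCombination_apply ..
  have hsurj : Function.Surjective L := by
    intro v
    let g : T → ℝ := Pi.single ⟨a, ha⟩ ((W b ⨯₃ W c) ⬝ᵥ v / det3 (W a) (W b) (W c)) +
      Pi.single ⟨b, hb⟩ ((W c ⨯₃ W a) ⬝ᵥ v / det3 (W a) (W b) (W c)) +
      Pi.single ⟨c, hc⟩ ((W a ⨯₃ W b) ⬝ᵥ v / det3 (W a) (W b) (W c))
    refine ⟨g, ?_⟩
    have hsingle : ∀ (i : T) (r : ℝ), L (Pi.single i r) = r • W i := by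
      intro i r
      rw [hL, Finset.sum_eq_single i]
      · simp
      · intro j _ hj
        simp [Pi.single_eq_of_ne hj]
      · simp
    rw [map_add, map_add, hsingle, hsingle, hsingle]
    ext i
    simp only [Pi.add_apply, Pi.smul_apply, smul_eq_mul]
    field_simp
    fin_cases i <;>
      simp [det3, cross_apply, dotProduct, Fin.sum_univ_three] <;> ring
  let P : Set (T → ℝ) := Set.univ.pi fun _ => Set.Ioi 0
  have hPo : IsOpen P := isOpen_set_pi Set.finite_univ fun _ _ => isOpen_Ioi
  have hPc : Convex ℝ P := convex_pi fun _ _ => convex_Ioi 0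
  have hKo : IsOpen (L '' P) := L.isOpenMap_of_finiteDimensional hsurj _ hPo
  have hKc : Convex ℝ (L '' P) := hPc.linear_image L
  have h0 : (0 : Fin 3 → ℝ) ∉ L '' P := by
    rintro ⟨g, hg, hg0⟩
    refine h ⟨fun i => if hi : i ∈ T then g ⟨i, hi⟩ else 0, fun i hi => by simp [hi],
      fun i hi => ?_, ?_⟩
    · simpa [hi] using hg ⟨i, hi⟩ (Set.mem_univ _)
    · rw [hL] at hg0
      rw [← hg0, ← Finset.sum_subset (Finset.subset_univ T), ← Finset.sum_coe_sort]
      · simp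
      · intro i _ hi
        simp [hi]
  obtain ⟨f, hf⟩ := geometric_hahn_banach_point_open hKc hKo h0
  rw [map_zero] at hf
  let y : Fin 3 → ℝ := fun j => f (Pi.single j 1)
  have hfy : ∀ v, f v = y ⬝ᵥ v := by
    intro v
    conv_lhs => rw [pi_eq_sum_univ' v]
    simp [y, dotProduct, mul_comm]
  have hpos : ∀ g : T → ℝ, (∀ i, 0 < g i) → 0 < ∑ i, g i * (y ⬝ᵥ W i) := by
    intro g hg
    have := hf (L g) ⟨g, fun i _ => hg i, rfl⟩
    rw [hfy, hL, dotProduct_sum] at this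
    simpa [dotProduct_smul] using this
  have hnn : ∀ i ∈ T, 0 ≤ y ⬝ᵥ W i := by
    intro i hi
    by_contra! hneg
    set S := ∑ j : T, (y ⬝ᵥ W j) with hS
    have := hpos (fun j => 1 + if j = ⟨i, hi⟩ then |S| / (-(y ⬝ᵥ W i)) else 0) (by
      intro j
      have : 0 ≤ |S| / (-(y ⬝ᵥ W i)) := div_nonneg (abs_nonneg _) (by linarith)
      split_ifs <;> linarith)
    simp only [add_mul, one_mul, Finset.sum_add_distrib, ite_mul, zero_mul,
      Finset.sum_ite_eq', Finset.mem_univ, if_true] at this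
    have h3 : |S| / (-(y ⬝ᵥ W i)) * (y ⬝ᵥ W i) = -|S| := by
      have : y ⬝ᵥ W i ≠ 0 := hneg.ne
      field_simp
    rw [h3] at this
    have := le_abs_self S
    linarith
  refine ⟨y, hnn, ?_⟩
  by_contra! hle
  have := hpos (fun _ => 1) fun _ => one_pos
  refine absurd this (not_lt.mpr (Finset.sum_nonpos fun i _ => ?_))
  simpa using hle i i.2

theorem IsUniformConfiguration.exists_vertex {W : ι → Fin 3 → ℝ} (hW : IsUniformConfiguration W)
    {T : Finset ι} (hT : 3 ≤ T.card) {y : Fin 3 → ℝ} (hy0 : y ≠ 0)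
    (hy : ∀ i ∈ T, 0 ≤ y ⬝ᵥ W i) :
    ∃ u : Fin 3 → ℝ, u ≠ 0 ∧ (∀ i ∈ T, 0 ≤ u ⬝ᵥ W i) ∧
      ∃ a ∈ T, ∃ b ∈ T, a ≠ b ∧ u ⬝ᵥ W a = 0 ∧ u ⬝ᵥ W b = 0 := by
  obtain ⟨u, hu0, hu, a, ha, hua⟩ : ∃ u : Fin 3 → ℝ, u ≠ 0 ∧ (∀ i ∈ T, 0 ≤ u ⬝ᵥ W i) ∧
      ∃ a ∈ T, u ⬝ᵥ W a = 0 := by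
    by_cases hz : ∃ a ∈ T, y ⬝ᵥ W a = 0
    · exact ⟨y, hy0, hy, hz⟩
    push Not at hz
    obtain ⟨a, b, c, ha, hb, hc, hab, hac, hbc⟩ := Finset.two_lt_card_iff.mp hT
    obtain ⟨z, hza, -, hzc⟩ := exists_neg_cross hW hab hac hbc
    obtain ⟨t, ht, s, hs, -, hus⟩ := exists_slide hy hc hzc
    refine ⟨_, ?_, ht, s, hs, hus⟩
    intro h0
    apply hz a ha
    have : (y + t • z) ⬝ᵥ W a = 0 := by rw [h0, zero_dotProduct]
    simpa [add_dotProduct, smul_dotProduct, hza] using this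
  obtain ⟨b, hb, c, hc, hbc⟩ : ∃ b ∈ T.erase a, ∃ c ∈ T.erase a, b ≠ c := by
    apply Finset.one_lt_card.mp
    rw [Finset.card_erase_of_mem ha]
    omega
  rw [Finset.mem_erase] at hb hc
  by_cases hub : u ⬝ᵥ W b = 0
  · exact ⟨u, hu0, hu, a, ha, b, hb.2, hb.1.symm, hua, hub⟩
  obtain ⟨z, hza, hzb, hzc⟩ := exists_neg_cross hW hb.1.symm hc.1.symm hbc
  obtain ⟨t, ht, s, hs, hzs, hus⟩ := exists_slide hu hc.2 hzc
  refine ⟨_, ?_, ht, a, ha, s, hs, ?_, ?_, hus⟩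
  · intro h0
    apply hub
    have : (u + t • z) ⬝ᵥ W b = 0 := by rw [h0, zero_dotProduct]
    simpa [add_dotProduct, smul_dotProduct, hzb] using this
  · rintro rfl
    linarith
  · simp [add_dotProduct, smul_dotProduct, hua, hza]

end VectorConfigurations

section BalancedConfigurations

open scoped Matrix

variable {ι : Type*} [Fintype ι] [DecidableEq ι]

theorem IsUniformConfiguration.cross_ne_zero {W : ι → Fin 3 → ℝ} (hW : IsUniformConfiguration W)
    (hcard : 3 ≤ Fintype.card ι) {a b : ι} (hab : a ≠ b) : W a ⨯₃ W b ≠ 0 := by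
  obtain ⟨c, -, -, hc⟩ := hW.exists_third hcard hab
  intro h0
  rw [det3_eq_cross, h0, zero_dotProduct] at hc
  exact hc rfl

theorem negativeSide_smul_cross {W : ι → Fin 3 → ℝ} {κ : ℝ} (hκ : κ ≠ 0) (a b : ι) :
    negativeSide W (κ • (W a ⨯₃ W b)) = negativeSide W (W a ⨯₃ W b) ∨
      negativeSide W (κ • (W a ⨯₃ W b)) = negativeSide W (W b ⨯₃ W a) := by
  rcases hκ.lt_or_gt with h | h
  · right
    ext i
    rw [mem_negativeSide, mem_negativeSide, smul_dotProduct, smul_eq_mul, ← cross_anticomm,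
      neg_dotProduct, mul_neg_iff]
    constructor
    · rintro (⟨h1, -⟩ | ⟨-, h1⟩) <;> linarith
    · intro h1
      right
      exact ⟨h, by linarith⟩
  · left
    ext i
    rw [mem_negativeSide, mem_negativeSide, smul_dotProduct, smul_eq_mul, mul_neg_iff]
    constructor
    · rintro (⟨-, h1⟩ | ⟨h1, -⟩) <;> linarith
    · intro h1
      exact Or.inl ⟨h, h1⟩

theorem IsUniformConfiguration.isBalancedConfiguration {n : ℕ} {W : ι → Fin 3 → ℝ}
    (hW : IsUniformConfiguration W) (hn : 3 ≤ n) (hcard : Fintype.card ι = 2 * n)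
    (h : ∀ a b, a ≠ b → n ≤ (negativeSide W (W a ⨯₃ W b)).card + 1) :
    IsBalancedConfiguration n W := by
  intro y hy
  have hc := Finset.card_compl (negativeSide W y)
  have hle := Finset.card_le_univ (negativeSide W y)
  by_cases hT : 3 ≤ (negativeSide W y)ᶜ.card
  · obtain ⟨u, hu0, hu, a, ha, b, hb, hab, hua, hub⟩ := hW.exists_vertex hT hy (by
      intro i hi
      rw [Finset.mem_compl, mem_negativeSide] at hi
      linarith)
    obtain ⟨c, -, -, hD⟩ := hW.exists_third (by omega) hab
    obtain ⟨κ, rfl⟩ := exists_smul_cross_eq hD hua hub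
    have hκ : κ ≠ 0 := by
      rintro rfl
      simp at hu0
    have hsub : negativeSide W (κ • (W a ⨯₃ W b)) ⊆ negativeSide W y := by
      intro i hi
      by_contra hi'
      rw [mem_negativeSide] at hi
      exact absurd (hu i (Finset.mem_compl.mpr hi')) (not_le.mpr hi)
    have hle := Finset.card_le_card hsub
    rcases negativeSide_smul_cross (W := W) hκ a b with h1 | h1
    · have := h a b hab
      rw [h1] at hle
      omega
    · have := h b a hab.symm
      rw [h1] at hle
      omega
  · omega

theorem IsBalancedConfiguration.hasPositiveDependency {n : ℕ} {W : ι → Fin 3 → ℝ}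
    (hB : IsBalancedConfiguration n W) (hW : IsUniformConfiguration W)
    (hcard : Fintype.card ι = 2 * n) {T : Finset ι} (hT : Tᶜ.card + 2 ≤ n) :
    HasPositiveDependency W T := by
  by_contra h
  have hc := Finset.card_compl T
  have hle := Finset.card_le_univ T
  obtain ⟨y, hy, i, -, hi⟩ := exists_nonneg_of_not_hasPositiveDependency hW (by omega) h
  have hy0 : y ≠ 0 := by
    rintro rfl
    simp at hi
  have hsub : negativeSide W y ⊆ Tᶜ := by
    intro j hj
    rw [Finset.mem_compl]
    intro hjT
    exact absurd (hy j hjT) (not_le.mpr (mem_negativeSide.mp hj))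
  have := Finset.card_le_card hsub
  have := hB y hy0
  omega

theorem isBalancedConfiguration_of_hasPositiveDependency {n : ℕ} {W : ι → Fin 3 → ℝ}
    (hn : 2 ≤ n) (h : ∀ T : Finset ι, Tᶜ.card + 2 ≤ n → HasPositiveDependency W T) {a b c : ι}
    (hD : det3 (W a) (W b) (W c) ≠ 0) : IsBalancedConfiguration n W := by
  intro y hy0
  by_contra hlt
  have h1 := (h (negativeSide W y)ᶜ (by rw [compl_compl]; omega)).dotProduct_eq_zero (y := y) (by
    intro i hi
    rw [Finset.mem_compl, mem_negativeSide] at hi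
    linarith)
  have hnonpos : ∀ i, y ⬝ᵥ W i ≤ 0 := by
    intro i
    by_cases hi : i ∈ negativeSide W y
    · exact (mem_negativeSide.mp hi).le
    · exact (h1 i (Finset.mem_compl.mpr hi)).le
  have h2 := (h Finset.univ (by simpa using hn)).dotProduct_eq_zero (y := -y) (by
    intro i _
    rw [neg_dotProduct]
    linarith [hnonpos i])
  simp only [neg_dotProduct, neg_eq_zero, Finset.mem_univ, true_imp_iff] at h2
  exact hy0 (eq_zero_of_dotProduct_eq_zero hD (h2 a) (h2 b) (h2 c))

theorem card_negativeSide_add_card_le {W : ι → Fin 3 → ℝ} {y : Fin 3 → ℝ} {s : Finset ι}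
    (h : ∀ i ∈ s, y ⬝ᵥ W i = 0) :
    (negativeSide W y).card + (negativeSide W (-y)).card + s.card ≤ Fintype.card ι := by
  rw [← Finset.card_union_of_disjoint (disjoint_negativeSide_neg W y),
    ← Finset.card_union_of_disjoint]
  · exact Finset.card_le_univ _
  · rw [Finset.disjoint_left]
    intro i hi his
    rw [Finset.mem_union, mem_negativeSide, mem_negativeSide_neg, h i his] at hi
    simp at hi

theorem IsBalancedConfiguration.isUniformConfiguration {n : ℕ} {W : ι → Fin 3 → ℝ}
    (hB : IsBalancedConfiguration n W) (hcard : Fintype.card ι = 2 * n) :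
    IsUniformConfiguration W := by
  intro i j k hij hik hjk h0
  obtain ⟨y, hy0, hi, hj, hk⟩ := exists_normal_of_det3_eq_zero h0
  have h1 := hB y hy0
  have h2 := hB (-y) (neg_ne_zero.mpr hy0)
  have h3 := card_negativeSide_add_card_le (W := W) (y := y) (s := {i, j, k}) (by simp [hi, hj, hk])
  rw [Finset.card_eq_three.mpr ⟨i, j, k, hij, hik, hjk, rfl⟩] at h3
  omega

theorem HasPositiveDependency.empty (W : ι → Fin 3 → ℝ) : HasPositiveDependency W ∅ :=
  ⟨0, by simp⟩

theorem HasPositiveDependency.eq_empty_of_card_le {W : ι → Fin 3 → ℝ}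
    (hW : IsUniformConfiguration W) (hcard : 3 ≤ Fintype.card ι) {T : Finset ι}
    (h : HasPositiveDependency W T) (hT : T.card ≤ 3) : T = ∅ := by
  obtain ⟨T', hTT', hT'⟩ := Finset.exists_superset_card_eq hT (by simpa using hcard)
  obtain ⟨x, y, z, hxy, hxz, hyz, rfl⟩ := Finset.card_eq_three.mp hT'
  have key : ∀ p q r, T ⊆ {p, q, r} → p ≠ q → p ≠ r → q ≠ r → p ∉ T := by
    intro p q r hsub hpq hpr hqr hp
    have hD := hW q r p hqr hpq.symm hpr.symm
    have := h.dotProduct_eq_zero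
      (y := det3 (W q) (W r) (W p) • (W q ⨯₃ W r)) (by
        intro i hi
        have := hsub hi
        simp only [Finset.mem_insert, Finset.mem_singleton] at this
        rw [smul_dotProduct, ← det3_eq_cross, smul_eq_mul]
        rcases this with rfl | rfl | rfl
        · exact mul_self_nonneg _
        · simp [det3_self_outer]
        · simp [det3_self_right]) p hp
    rw [smul_dotProduct, ← det3_eq_cross, smul_eq_mul] at this
    exact hD (mul_self_eq_zero.mp this)
  rw [Finset.eq_empty_iff_forall_notMem]
  intro i hi
  have := hTT' hi
  simp only [Finset.mem_insert, Finset.mem_singleton] at this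
  rcases this with rfl | rfl | rfl
  · exact key _ _ _ hTT' hxy hxz hyz hi
  · exact key i z x (fun j hj => by have := hTT' hj; simp at this ⊢; tauto) hyz hxy.symm
      hxz.symm hi
  · exact key i x y (fun j hj => by have := hTT' hj; simp at this ⊢; tauto) hxz.symm hyz.symm
      hxy hi

theorem HasPositiveDependency.of_sign_eq {W W' : ι → Fin 3 → ℝ} (hW : IsUniformConfiguration W)
    (hW' : IsUniformConfiguration W') (hcard : 3 ≤ Fintype.card ι)
    (hs : ∀ i j k, i ≠ j → i ≠ k → j ≠ k →
      0 < det3 (W i) (W j) (W k) * det3 (W' i) (W' j) (W' k))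
    {T : Finset ι} (h : HasPositiveDependency W T) : HasPositiveDependency W' T := by
  by_cases hT : T.card ≤ 3
  · rw [h.eq_empty_of_card_le hW hcard hT]
    exact .empty W'
  by_contra h'
  push Not at hT
  obtain ⟨y, hy, i, -, hi⟩ := exists_nonneg_of_not_hasPositiveDependency hW' hT.le h'
  have hy0 : y ≠ 0 := by
    rintro rfl
    simp at hi
  obtain ⟨u, hu0, hu, a, ha, b, hb, hab, hua, hub⟩ := hW'.exists_vertex hT.le hy0 hy
  obtain ⟨d, -, -, hD⟩ := hW'.exists_third hcard hab
  obtain ⟨κ, rfl⟩ := exists_smul_cross_eq hD hua hub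
  have hκ : κ ≠ 0 := by
    rintro rfl
    simp at hu0
  obtain ⟨c, hc⟩ : ((T.erase a).erase b).Nonempty := by
    rw [← Finset.card_pos, Finset.card_erase_of_mem (by simp [hb, hab.symm]),
      Finset.card_erase_of_mem ha]
    omega
  simp only [Finset.mem_erase] at hc
  have := h.dotProduct_eq_zero (y := κ • (W a ⨯₃ W b)) (by
    intro i hi
    by_cases hia : i = a
    · rw [smul_dotProduct, ← det3_eq_cross, hia, det3_self_outer, smul_zero]
    by_cases hib : i = b
    · rw [smul_dotProduct, ← det3_eq_cross, hib, det3_self_right, smul_zero]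
    have h1 := hu i hi
    have h2 := hs a b i hab (Ne.symm hia) (Ne.symm hib)
    rw [smul_dotProduct, ← det3_eq_cross, smul_eq_mul] at h1 ⊢
    by_contra! h3
    nlinarith [mul_nonneg h1 h2.le, mul_self_pos.mpr (hW' a b i hab (Ne.symm hia) (Ne.symm hib))])
      c hc.2.2
  rw [smul_dotProduct, ← det3_eq_cross, smul_eq_mul] at this
  exact (mul_ne_zero hκ (hW a b c hab hc.2.1.symm hc.1.symm)) this

/-- In a balanced configuration both open sides of a plane spanned by two of the vectors contain
exactly `n - 1` vectors. -/
theorem IsBalancedConfiguration.negativeSide_vertex {n : ℕ} {W : ι → Fin 3 → ℝ}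
    (hB : IsBalancedConfiguration n W) (hcard : Fintype.card ι = 2 * n) {x a : ι} (hxa : x ≠ a)
    {y : Fin 3 → ℝ} (hy0 : y ≠ 0) (hyx : y ⬝ᵥ W x = 0) (hya : y ⬝ᵥ W a = 0) :
    (negativeSide W y).card + 1 = n ∧ (negativeSide W (-y)).card + 1 = n := by
  have h1 := hB y hy0
  have h2 := hB (-y) (neg_ne_zero.mpr hy0)
  have h3 := card_negativeSide_add_card_le (W := W) (y := y) (s := {x, a}) (by simp [hyx, hya])
  rw [Finset.card_pair hxa] at h3
  omega

theorem not_hasPositiveDependency_compl_negativeSide {W : ι → Fin 3 → ℝ} {y : Fin 3 → ℝ}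
    (h : (negativeSide W (-y)).Nonempty) : ¬HasPositiveDependency W (negativeSide W y)ᶜ := by
  intro hp
  obtain ⟨i, hi⟩ := h
  rw [mem_negativeSide_neg] at hi
  refine hi.ne' (hp.dotProduct_eq_zero (fun j hj => ?_) i ?_)
  · rw [Finset.mem_compl, mem_negativeSide] at hj
    linarith
  · rw [Finset.mem_compl, mem_negativeSide]
    linarith

theorem IsBalancedConfiguration.exists_negativeSide_eq {n : ℕ} {W : ι → Fin 3 → ℝ}
    (hB : IsBalancedConfiguration n W) (hW : IsUniformConfiguration W) (hn : 2 ≤ n)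
    (hcard : Fintype.card ι = 2 * n) {S : Finset ι} (hS : S.card + 1 = n)
    (h : ¬HasPositiveDependency W Sᶜ) : ∃ y : Fin 3 → ℝ, y ≠ 0 ∧ negativeSide W y = S := by
  have hc := Finset.card_compl S
  obtain ⟨y, hy, i, -, hi⟩ := exists_nonneg_of_not_hasPositiveDependency hW (by omega) h
  have hy0 : y ≠ 0 := by
    rintro rfl
    simp at hi
  refine ⟨y, hy0, Finset.eq_of_subset_of_card_le (fun j hj => ?_) ?_⟩
  · by_contra hjS
    exact absurd (hy j (Finset.mem_compl.mpr hjS)) (not_le.mpr (mem_negativeSide.mp hj))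
  · have := hB y hy0
    omega

theorem IsBalancedConfiguration.exists_exchange {n : ℕ} {W : ι → Fin 3 → ℝ}
    (hB : IsBalancedConfiguration n W) (hW : IsUniformConfiguration W) (hn : 3 ≤ n)
    (hcard : Fintype.card ι = 2 * n) {x a : ι} (hxa : x ≠ a) {y : Fin 3 → ℝ} (hy0 : y ≠ 0)
    (hyx : y ⬝ᵥ W x = 0) (hya : y ⬝ᵥ W a = 0) :
    ∃ s ∈ negativeSide W y, ∃ u : Fin 3 → ℝ, u ≠ 0 ∧
      negativeSide W u = insert x ((negativeSide W y).erase s) := by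
  obtain ⟨hN, hP⟩ := hB.negativeSide_vertex hcard hxa hy0 hyx hya
  obtain ⟨b, hba, hbx, -⟩ := hW.exists_third (by omega) hxa.symm
  obtain ⟨z, hza, -, hzx⟩ := exists_neg_cross hW hba.symm hxa.symm hbx
  obtain ⟨d, -, -, hD⟩ := hW.exists_third (by omega) hxa
  have hne : ∀ c, c ≠ x → c ≠ a → y ⬝ᵥ W c ≠ 0 := by
    intro c hcx hca h0
    exact hy0 (eq_zero_of_dotProduct_eq_zero (hW x a c hxa hcx.symm hca.symm) hyx hya h0)
  have hmem : b ∈ ({x, a} : Finset ι)ᶜ := by simp [hba, hbx]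
  obtain ⟨s, hs, hmin⟩ := Finset.exists_min_image ({x, a} : Finset ι)ᶜ
    (fun c => (z ⬝ᵥ W c) / (y ⬝ᵥ W c)) ⟨b, hmem⟩
  simp only [Finset.mem_compl, Finset.mem_insert, Finset.mem_singleton, not_or] at hs hmin
  set t := (z ⬝ᵥ W s) / (y ⬝ᵥ W s) with ht
  set u := z - t • y with hu
  have huW : ∀ c, u ⬝ᵥ W c = z ⬝ᵥ W c - t * (y ⬝ᵥ W c) := by
    intro c
    rw [hu, sub_dotProduct, smul_dotProduct, smul_eq_mul]
  have hux : u ⬝ᵥ W x < 0 := by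
    rw [huW, hyx]
    linarith
  have hua : u ⬝ᵥ W a = 0 := by rw [huW, hya, hza]; ring
  have hus : u ⬝ᵥ W s = 0 := by
    rw [huW, ht]
    field_simp [hne s hs.1 hs.2]
    ring
  have hu0 : u ≠ 0 := by
    intro h0
    rw [h0, zero_dotProduct] at hux
    exact lt_irrefl _ hux
  have hpos : ∀ c, 0 < y ⬝ᵥ W c → 0 ≤ u ⬝ᵥ W c := by
    intro c hc
    have := hmin c ⟨by rintro rfl; linarith, by rintro rfl; linarith⟩
    rw [le_div_iff₀ hc] at this
    rw [huW]
    linarith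
  have hneg : ∀ c, y ⬝ᵥ W c < 0 → u ⬝ᵥ W c ≤ 0 := by
    intro c hc
    have := hmin c ⟨by rintro rfl; linarith, by rintro rfl; linarith⟩
    rw [le_div_iff_of_neg hc] at this
    rw [huW]
    linarith
  rcases (hne s hs.1 hs.2).lt_or_gt with hys | hys
  · refine ⟨s, mem_negativeSide.mpr hys, u, hu0, Finset.eq_of_subset_of_card_le ?_ ?_⟩
    · intro c hc
      rw [mem_negativeSide] at hc
      rw [Finset.mem_insert, Finset.mem_erase, mem_negativeSide]
      by_cases hcx : c = x
      · exact Or.inl hcx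
      right
      refine ⟨?_, ?_⟩
      · rintro rfl
        linarith
      · have hca : c ≠ a := by
          rintro rfl
          linarith
        refine (hne c hcx hca).lt_or_gt.resolve_right fun h => ?_
        linarith [hpos c h]
    · rw [Finset.card_insert_of_notMem (by simp [mem_negativeSide, hyx]),
        Finset.card_erase_of_mem (mem_negativeSide.mpr hys)]
      have := hB u hu0
      omega
  · exfalso
    have hsub : negativeSide W (-u) ⊆ (negativeSide W (-y)).erase s := by
      intro c hc
      rw [mem_negativeSide_neg] at hc
      rw [Finset.mem_erase, mem_negativeSide_neg]
      refine ⟨?_, ?_⟩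
      · rintro rfl
        linarith
      · refine (hne c ?_ ?_).lt_or_gt.resolve_left fun h => ?_
        · rintro rfl
          linarith
        · rintro rfl
          linarith
        · linarith [hneg c h]
    have h1 := Finset.card_le_card hsub
    rw [Finset.card_erase_of_mem (mem_negativeSide_neg.mpr hys)] at h1
    have := hB (-u) (neg_ne_zero.mpr hu0)
    omega

theorem exists_negativeSide_eq_of_hasPositiveDependency_iff {n : ℕ} {W W' : ι → Fin 3 → ℝ}
    (hB : IsBalancedConfiguration n W) (hW : IsUniformConfiguration W)
    (hB' : IsBalancedConfiguration n W') (hW' : IsUniformConfiguration W') (hn : 3 ≤ n)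
    (hcard : Fintype.card ι = 2 * n)
    (h : ∀ T, HasPositiveDependency W' T → HasPositiveDependency W T) {x a : ι} (hxa : x ≠ a)
    {y : Fin 3 → ℝ} (hy0 : y ≠ 0) (hyx : y ⬝ᵥ W x = 0) (hya : y ⬝ᵥ W a = 0) :
    ∃ u : Fin 3 → ℝ, u ≠ 0 ∧ u ⬝ᵥ W' x = 0 ∧ negativeSide W' u = negativeSide W y := by
  obtain ⟨hN, hP⟩ := hB.negativeSide_vertex hcard hxa hy0 hyx hya
  obtain ⟨s, hs, z, hz0, hz⟩ := hB.exists_exchange hW hn hcard hxa hy0 hyx hya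
  have hxN : x ∉ (negativeSide W y).erase s := by simp [mem_negativeSide, hyx]
  have hc2 : (insert x ((negativeSide W y).erase s)).card + 1 = n := by
    rw [Finset.card_insert_of_notMem hxN, Finset.card_erase_of_mem hs]
    omega
  have hne : ∀ w : Fin 3 → ℝ, w ≠ 0 → (negativeSide W (-w)).Nonempty := by
    intro w hw
    have := hB (-w) (neg_ne_zero.mpr hw)
    rw [← Finset.card_pos]
    omega
  obtain ⟨p, hp0, hp⟩ := hB'.exists_negativeSide_eq hW' (by omega) hcard hN
    fun hd => not_hasPositiveDependency_compl_negativeSide (hne y hy0) (h _ hd)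
  obtain ⟨q, hq0, hq⟩ := hB'.exists_negativeSide_eq hW' (by omega) hcard hc2 (by
    rw [← hz]
    exact fun hd => not_hasPositiveDependency_compl_negativeSide (hne z hz0) (h _ hd))
  have hpmem : ∀ c, p ⬝ᵥ W' c < 0 ↔ c ∈ negativeSide W y := by
    intro c
    rw [← hp, mem_negativeSide]
  have hqmem : ∀ c, q ⬝ᵥ W' c < 0 ↔ c = x ∨ c ≠ s ∧ c ∈ negativeSide W y := by
    intro c
    rw [← mem_negativeSide, hq, Finset.mem_insert, Finset.mem_erase]
  have hpx : 0 ≤ p ⬝ᵥ W' x := by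
    rw [← not_lt, hpmem, mem_negativeSide, hyx]
    exact lt_irrefl _
  have hqx : q ⬝ᵥ W' x < 0 := (hqmem x).mpr (Or.inl rfl)
  set u := (p ⬝ᵥ W' x) • q - (q ⬝ᵥ W' x) • p with hu
  have huW : ∀ c, u ⬝ᵥ W' c = (p ⬝ᵥ W' x) * (q ⬝ᵥ W' c) - (q ⬝ᵥ W' x) * (p ⬝ᵥ W' c) := by
    intro c
    rw [hu, sub_dotProduct, smul_dotProduct, smul_dotProduct, smul_eq_mul, smul_eq_mul]
  have hu0 : u ≠ 0 := by
    obtain ⟨c, hc⟩ : ((negativeSide W y).erase s).Nonempty := by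
      rw [← Finset.card_pos, Finset.card_erase_of_mem hs]
      omega
    rw [Finset.mem_erase] at hc
    have h1 := (hpmem c).mpr hc.2
    have h2 := (hqmem c).mpr (Or.inr hc)
    intro h0
    have h3 := huW c
    rw [h0, zero_dotProduct] at h3
    have := mul_pos_of_neg_of_neg hqx h1
    have := mul_nonpos_of_nonneg_of_nonpos hpx h2.le
    linarith
  have hux : u ⬝ᵥ W' x = 0 := by
    rw [huW]
    ring
  refine ⟨u, hu0, hux, Finset.eq_of_subset_of_card_le (fun c hc => ?_) ?_⟩
  · by_contra hcN
    have hcx : c ≠ x := by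
      rintro rfl
      rw [mem_negativeSide] at hc
      linarith
    have h1 : 0 ≤ p ⬝ᵥ W' c := not_lt.mp fun h' => hcN ((hpmem c).mp h')
    have h2 : 0 ≤ q ⬝ᵥ W' c := by
      rw [← not_lt, hqmem]
      tauto
    rw [mem_negativeSide, huW] at hc
    have := mul_nonneg hpx h2
    have := mul_nonpos_of_nonpos_of_nonneg hqx.le h1
    linarith
  · have := hB' u hu0
    omega

theorem exists_smul_cross_negativeSide_eq {n : ℕ} {W W' : ι → Fin 3 → ℝ}
    (hB : IsBalancedConfiguration n W) (hW : IsUniformConfiguration W)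
    (hB' : IsBalancedConfiguration n W') (hW' : IsUniformConfiguration W') (hn : 3 ≤ n)
    (hcard : Fintype.card ι = 2 * n)
    (h : ∀ T, HasPositiveDependency W' T → HasPositiveDependency W T) {x a : ι} (hxa : x ≠ a) :
    ∃ κ : ℝ, ∀ c, c ≠ x → c ≠ a →
      0 < κ * (det3 (W x) (W a) (W c) * det3 (W' x) (W' a) (W' c)) := by
  set y := W x ⨯₃ W a with hy
  have hy0 : y ≠ 0 := hW.cross_ne_zero (by omega) hxa
  have hyx : y ⬝ᵥ W x = 0 := by rw [hy, ← det3_eq_cross, det3_self_outer]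
  have hya : y ⬝ᵥ W a = 0 := by rw [hy, ← det3_eq_cross, det3_self_right]
  obtain ⟨hN, hP⟩ := hB.negativeSide_vertex hcard hxa hy0 hyx hya
  obtain ⟨p, hp0, hpx, hp⟩ := exists_negativeSide_eq_of_hasPositiveDependency_iff hB hW hB' hW' hn
    hcard h hxa hy0 hyx hya
  obtain ⟨q, hq0, hqx, hq⟩ := exists_negativeSide_eq_of_hasPositiveDependency_iff hB hW hB' hW' hn
    hcard h hxa (neg_ne_zero.mpr hy0) (by simp [hyx]) (by simp [hya])
  have hpmem : ∀ c, p ⬝ᵥ W' c < 0 ↔ y ⬝ᵥ W c < 0 := fun c => by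
    rw [← mem_negativeSide, hp, mem_negativeSide]
  have hqmem : ∀ c, q ⬝ᵥ W' c < 0 ↔ 0 < y ⬝ᵥ W c := fun c => by
    rw [← mem_negativeSide, hq, mem_negativeSide_neg]
  have hpa : 0 ≤ p ⬝ᵥ W' a := by
    rw [← not_lt, hpmem, hya]
    exact lt_irrefl _
  have hqa : 0 ≤ q ⬝ᵥ W' a := by
    rw [← not_lt, hqmem, hya]
    exact lt_irrefl _
  have hne : ∀ c, c ≠ x → c ≠ a → y ⬝ᵥ W c ≠ 0 := by
    intro c hcx hca
    rw [hy, ← det3_eq_cross]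
    exact hW x a c hxa hcx.symm hca.symm
  obtain ⟨i, hi⟩ : (negativeSide W y).Nonempty := by
    rw [← Finset.card_pos]
    omega
  rw [mem_negativeSide] at hi
  obtain ⟨j, hj⟩ : (negativeSide W (-y)).Nonempty := by
    rw [← Finset.card_pos]
    omega
  rw [mem_negativeSide_neg] at hj
  obtain ⟨v, hv0, hvx, hva, hvn, hvp⟩ : ∃ v : Fin 3 → ℝ, v ≠ 0 ∧ v ⬝ᵥ W' x = 0 ∧ v ⬝ᵥ W' a = 0 ∧
      (∀ c, y ⬝ᵥ W c < 0 → v ⬝ᵥ W' c ≤ 0) ∧ ∀ c, 0 < y ⬝ᵥ W c → 0 ≤ v ⬝ᵥ W' c := by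
    by_cases hz : p ⬝ᵥ W' a = 0
    · refine ⟨p, hp0, hpx, hz, fun c hc => ((hpmem c).mpr hc).le, fun c hc => ?_⟩
      rw [← not_lt, hpmem]
      exact not_lt.mpr hc.le
    · have hvW : ∀ c, ((q ⬝ᵥ W' a) • p - (p ⬝ᵥ W' a) • q) ⬝ᵥ W' c =
          (q ⬝ᵥ W' a) * (p ⬝ᵥ W' c) - (p ⬝ᵥ W' a) * (q ⬝ᵥ W' c) := by
        intro c
        rw [sub_dotProduct, smul_dotProduct, smul_dotProduct, smul_eq_mul, smul_eq_mul]
      have hpos : ∀ c, 0 < y ⬝ᵥ W c → 0 ≤ p ⬝ᵥ W' c := by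
        intro c hc
        rw [← not_lt, hpmem]
        exact not_lt.mpr hc.le
      have hneg : ∀ c, y ⬝ᵥ W c < 0 → 0 ≤ q ⬝ᵥ W' c := by
        intro c hc
        rw [← not_lt, hqmem]
        exact not_lt.mpr hc.le
      refine ⟨(q ⬝ᵥ W' a) • p - (p ⬝ᵥ W' a) • q, ?_, ?_, ?_, ?_, ?_⟩
      · intro h0
        have h1 := hvW j
        rw [h0, zero_dotProduct] at h1
        have h2 := mul_neg_of_pos_of_neg (lt_of_le_of_ne hpa (Ne.symm hz)) ((hqmem j).mpr hj)
        have h3 := mul_nonneg hqa (hpos j hj)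
        linarith
      · rw [hvW, hpx, hqx]
        ring
      · rw [hvW]
        ring
      · intro c hc
        rw [hvW]
        have h2 := mul_nonpos_of_nonneg_of_nonpos hqa ((hpmem c).mpr hc).le
        have h3 := mul_nonneg hpa (hneg c hc)
        linarith
      · intro c hc
        rw [hvW]
        have h2 := mul_nonpos_of_nonneg_of_nonpos hpa ((hqmem c).mpr hc).le
        have h3 := mul_nonneg hqa (hpos c hc)
        linarith
  obtain ⟨d, -, -, hD⟩ := hW'.exists_third (by omega) hxa
  obtain ⟨κ, rfl⟩ := exists_smul_cross_eq hD hvx hva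
  refine ⟨κ, fun c hcx hca => ?_⟩
  have hvc : κ * det3 (W' x) (W' a) (W' c) ≠ 0 := by
    refine mul_ne_zero ?_ (hW' x a c hxa hcx.symm hca.symm)
    rintro rfl
    simp at hv0
  have h1 := hvn c
  have h2 := hvp c
  simp only [smul_dotProduct, ← det3_eq_cross, smul_eq_mul, hy] at h1 h2
  have h3 := hW x a c hxa hcx.symm hca.symm
  rw [mul_left_comm]
  rcases h3.lt_or_gt with h4 | h4
  · exact mul_pos_of_neg_of_neg h4 (lt_of_le_of_ne (h1 h4) hvc)
  · exact mul_pos h4 (lt_of_le_of_ne (h2 h4) hvc.symm)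

/-- Balanced configurations are determined, up to orientation, by the supports of their
positive dependencies. -/
theorem sign_eq_of_hasPositiveDependency_iff {n : ℕ} {W W' : ι → Fin 3 → ℝ}
    (hB : IsBalancedConfiguration n W) (hW : IsUniformConfiguration W)
    (hB' : IsBalancedConfiguration n W') (hW' : IsUniformConfiguration W') (hn : 3 ≤ n)
    (hcard : Fintype.card ι = 2 * n)
    (h : ∀ T, HasPositiveDependency W' T → HasPositiveDependency W T) {p q r : ι} (hpq : p ≠ q)
    (hpr : p ≠ r) (hqr : q ≠ r) (hpos : 0 < det3 (W p) (W q) (W r) * det3 (W' p) (W' q) (W' r))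
    (i j k : ι) (hij : i ≠ j) (hik : i ≠ k) (hjk : j ≠ k) :
    0 < det3 (W i) (W j) (W k) * det3 (W' i) (W' j) (W' k) := by
  have hrot : ∀ {a b c}, 0 < det3 (W a) (W b) (W c) * det3 (W' a) (W' b) (W' c) →
      0 < det3 (W b) (W c) (W a) * det3 (W' b) (W' c) (W' a) := by
    intro a b c habc
    rwa [det3_rotate (W a), det3_rotate (W' a)] at habc
  have hswap : ∀ {a b c}, 0 < det3 (W a) (W b) (W c) * det3 (W' a) (W' b) (W' c) →
      0 < det3 (W b) (W a) (W c) * det3 (W' b) (W' a) (W' c) := by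
    intro a b c habc
    rwa [det3_swap (W a), det3_swap (W' a), neg_mul_neg] at habc
  have hstep : ∀ {a b c}, a ≠ b → a ≠ c → b ≠ c →
      0 < det3 (W a) (W b) (W c) * det3 (W' a) (W' b) (W' c) →
      ∀ d, d ≠ a → d ≠ b → 0 < det3 (W a) (W b) (W d) * det3 (W' a) (W' b) (W' d) := by
    intro a b c hab hac hbc habc d hda hdb
    obtain ⟨κ, hκ⟩ := exists_smul_cross_negativeSide_eq hB hW hB' hW' hn hcard h hab
    have h1 := hκ c hac.symm hbc.symm
    have h2 := hκ d hda hdb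
    have hκ0 : 0 < κ := pos_of_mul_pos_left h1 habc.le
    exact pos_of_mul_pos_right h2 hκ0.le
  have h1 : ∀ c, c ≠ p → c ≠ q → 0 < det3 (W p) (W q) (W c) * det3 (W' p) (W' q) (W' c) :=
    hstep hpq hpr hqr hpos
  have h2 : ∀ b c, b ≠ p → c ≠ p → b ≠ c →
      0 < det3 (W p) (W b) (W c) * det3 (W' p) (W' b) (W' c) := by
    intro b c hb hc hbc
    by_cases hbq : b = q
    · subst hbq
      exact h1 c hc hbc.symm
    · have h3 := hrot (hrot (h1 b hb hbq))
      exact hswap (hstep hb hbq hpq h3 c hbc.symm hc)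
  by_cases hip : i = p
  · subst hip
    exact h2 j k hij.symm hik.symm hjk
  by_cases hjp : j = p
  · subst hjp
    exact hrot (hrot (h2 k i hjk.symm hij hik.symm))
  by_cases hkp : k = p
  · subst hkp
    exact hrot (h2 i j hik hjk hij)
  have h3 := hrot (h2 j k hjp hkp hjk)
  exact hrot (hrot (hstep hjk hjp hkp h3 i hij hik))

end BalancedConfigurations

section DoublingSigns

/-- The first nonzero number among `x`, `y`, `z`. -/
def firstNonzero (x y z : ℝ) : ℝ := if x ≠ 0 then x else if y ≠ 0 then y else z

theorem firstNonzero_of_ne {x : ℝ} (hx : x ≠ 0) (y z : ℝ) : firstNonzero x y z = x := by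
  simp [firstNonzero, hx]

theorem firstNonzero_zero_of_ne {y : ℝ} (hy : y ≠ 0) (z : ℝ) : firstNonzero 0 y z = y := by
  simp [firstNonzero, hy]

theorem firstNonzero_zero_zero (z : ℝ) : firstNonzero 0 0 z = z := by
  simp [firstNonzero]

/-- The sign of `det(W a, W b, x)` for the point `x` added at index `m` when the first `n`
vectors are doubled: `x` is `W 0 + ε W 1 + ε² W 2` for `m = n` and
`-(W k + ε W 0 + ε² W n)` for `m = n + k`. -/
def doublingRule (n m : ℕ) (s : ℕ → ℕ → ℕ → ℝ) (a b : ℕ) : ℝ :=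
  if m = n then firstNonzero (s a b 0) (s a b 1) (s a b 2)
  else -firstNonzero (s a b (m - n)) (s a b 0) (s a b n)

/-- The sign functions of the doubled configurations. -/
structure IsDoublingSign (n : ℕ) (s : ℕ → ℕ → ℕ → ℝ) : Prop where
  swap : ∀ a b c, s a b c = -s b a c
  rotate : ∀ a b c, s a b c = s b c a
  ne_zero : ∀ a b c, a < n → b < n → c < n → a ≠ b → a ≠ c → b ≠ c → s a b c ≠ 0
  step : ∀ m, n ≤ m → m < 2 * n → ∀ a b, a < m → b < m → s a b m = doublingRule n m s a b

/-- The index `a < 2 * n` is a copy of `α < n`, with orientation `ε`. -/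
def IsCopy (n a α : ℕ) (ε : ℝ) : Prop :=
  α < n ∧ ((a = α ∧ ε = 1) ∨ (a = n ∧ α = 0 ∧ ε = 1) ∨ (a = n + α ∧ α ≠ 0 ∧ ε = -1))

theorem exists_isCopy {n a : ℕ} (hn : 0 < n) (ha : a < 2 * n) : ∃ α ε, IsCopy n a α ε := by
  by_cases h1 : a < n
  · exact ⟨a, 1, h1, Or.inl ⟨rfl, rfl⟩⟩
  · by_cases h2 : a = n
    · exact ⟨0, 1, hn, Or.inr (Or.inl ⟨h2, rfl, rfl⟩)⟩
    · exact ⟨a - n, -1, by omega, Or.inr (Or.inr ⟨by omega, by omega, rfl⟩)⟩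

theorem isCopy_self {n a : ℕ} (ha : a < n) : IsCopy n a a 1 := ⟨ha, Or.inl ⟨rfl, rfl⟩⟩

theorem isCopy_add {n k : ℕ} (hk : k < n) (hk0 : k ≠ 0) : IsCopy n (n + k) k (-1) :=
  ⟨hk, Or.inr (Or.inr ⟨rfl, hk0, rfl⟩)⟩

theorem isCopy_zero {n : ℕ} (hn : 0 < n) : IsCopy n n 0 1 := ⟨hn, Or.inr (Or.inl ⟨rfl, rfl, rfl⟩)⟩

theorem IsCopy.lt {n a α : ℕ} {ε : ℝ} (h : IsCopy n a α ε) : a < 2 * n := by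
  obtain ⟨h1, h2⟩ := h
  omega

theorem IsCopy.sign_ne_zero {n a α : ℕ} {ε : ℝ} (h : IsCopy n a α ε) : ε ≠ 0 := by
  obtain ⟨-, ⟨-, rfl⟩ | ⟨-, -, rfl⟩ | ⟨-, -, rfl⟩⟩ := h <;> norm_num

theorem IsCopy.eq_or {n a α : ℕ} {ε : ℝ} (h : IsCopy n a α ε) (hα : α ≠ 0) :
    (a = α ∧ ε = 1) ∨ (a = n + α ∧ ε = -1) := by
  obtain ⟨-, h | h | h⟩ := h
  · exact Or.inl h
  · exact absurd h.2.1 hα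
  · exact Or.inr ⟨h.1, h.2.2⟩

namespace IsDoublingSign

variable {n : ℕ} {s : ℕ → ℕ → ℕ → ℝ}

theorem self_left (h : IsDoublingSign n s) (a c : ℕ) : s a a c = 0 := by
  linarith [h.swap a a c]

theorem self_right (h : IsDoublingSign n s) (a c : ℕ) : s a c c = 0 := by
  rw [h.rotate, h.self_left]

theorem self_outer (h : IsDoublingSign n s) (a c : ℕ) : s a c a = 0 := by
  rw [← h.rotate, h.self_left]

theorem swap_right (h : IsDoublingSign n s) (a b c : ℕ) : s a b c = -s a c b := by
  rw [← h.rotate c a b, h.swap c a b]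

theorem step_add (h : IsDoublingSign n s) {k : ℕ} (hk0 : k ≠ 0) (hk : k < n) {a b : ℕ}
    (ha : a < n + k) (hb : b < n + k) :
    s a b (n + k) = -firstNonzero (s a b k) (s a b 0) (s a b n) := by
  rw [h.step (n + k) (by omega) (by omega) a b ha hb, doublingRule, if_neg (by omega),
    Nat.add_sub_cancel_left]

theorem copy (h : IsDoublingSign n s) {a b c α β γ : ℕ} {ε δ ζ : ℝ} (ha : IsCopy n a α ε)
    (hb : IsCopy n b β δ) (hc : IsCopy n c γ ζ) (hαβ : α ≠ β) (hαγ : α ≠ γ) (hβγ : β ≠ γ) :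
    s a b c = ε * δ * ζ * s α β γ := by
  have key : ∀ M, ∀ a b c α β γ : ℕ, ∀ ε δ ζ : ℝ, a < M → b < M → c < M → IsCopy n a α ε →
      IsCopy n b β δ → IsCopy n c γ ζ → α ≠ β → α ≠ γ → β ≠ γ →
      s a b c = ε * δ * ζ * s α β γ := by
    intro M
    induction M with
    | zero => intro a b c α β γ ε δ ζ ha; omega
    | succ M ih =>
      have last : ∀ a b c α β γ : ℕ, ∀ ε δ ζ : ℝ, a < M → b < M → c ≤ M → IsCopy n a α ε →
          IsCopy n b β δ → IsCopy n c γ ζ → α ≠ β → α ≠ γ → β ≠ γ →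
          s a b c = ε * δ * ζ * s α β γ := by
        intro a b c α β γ ε δ ζ haM hbM hcM ha hb hc hαβ hαγ hβγ
        rcases hcM.lt_or_eq with hcM | rfl
        · exact ih a b c α β γ ε δ ζ haM hbM hcM ha hb hc hαβ hαγ hβγ
        obtain ⟨hγ, ⟨rfl, rfl⟩ | ⟨rfl, rfl, rfl⟩ | ⟨rfl, hγ0, rfl⟩⟩ := hc
        · obtain ⟨hα, ⟨rfl, rfl⟩ | ⟨rfl, rfl, rfl⟩ | ⟨rfl, hα0, rfl⟩⟩ := ha
          · obtain ⟨hβ, ⟨rfl, rfl⟩ | ⟨rfl, rfl, rfl⟩ | ⟨rfl, hβ0, rfl⟩⟩ := hb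
            · ring
            · omega
            · omega
          · omega
          · omega
        · obtain ⟨hα, ⟨rfl, rfl⟩ | ⟨rfl, rfl, rfl⟩ | ⟨rfl, hα0, rfl⟩⟩ := ha
          · obtain ⟨hβ, ⟨rfl, rfl⟩ | ⟨rfl, rfl, rfl⟩ | ⟨rfl, hβ0, rfl⟩⟩ := hb
            · rw [h.step _ le_rfl (by omega) a b haM hbM, doublingRule, if_pos rfl,
                firstNonzero_of_ne (h.ne_zero a b 0 hα hβ hγ hαβ hαγ hβγ)]
              ring
            · omega
            · omega
          · omega
          · omega
        · have h1 := ih a b γ α β γ ε δ 1 haM hbM (by omega) ha hb (isCopy_self hγ) hαβ hαγ hβγ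
          have h2 : s a b γ ≠ 0 := by
            rw [h1]
            exact mul_ne_zero (mul_ne_zero (mul_ne_zero ha.sign_ne_zero hb.sign_ne_zero) one_ne_zero)
              (h.ne_zero α β γ ha.1 hb.1 hγ hαβ hαγ hβγ)
          rw [h.step_add hγ0 hγ haM hbM, firstNonzero_of_ne h2, h1]
          ring
      intro a b c α β γ ε δ ζ haM hbM hcM ha hb hc hαβ hαγ hβγ
      have hab : a ≠ b := by obtain ⟨h1, h2⟩ := ha; obtain ⟨h3, h4⟩ := hb; omega
      have hac : a ≠ c := by obtain ⟨h1, h2⟩ := ha; obtain ⟨h3, h4⟩ := hc; omega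
      have hbc : b ≠ c := by obtain ⟨h1, h2⟩ := hb; obtain ⟨h3, h4⟩ := hc; omega
      by_cases haM' : a = M
      · rw [h.rotate a, h.rotate α, last b c a β γ α δ ζ ε (by omega) (by omega) (by omega) hb hc ha
          hβγ hαβ.symm hαγ.symm]
        ring
      by_cases hbM' : b = M
      · rw [← h.rotate c a b, ← h.rotate γ α β, last c a b γ α β ζ ε δ (by omega) (by omega)
          (by omega) hc ha hb hαγ.symm hβγ.symm hαβ]
        ring
      exact last a b c α β γ ε δ ζ (by omega) (by omega) (by omega) ha hb hc hαβ hαγ hβγ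
  exact key (2 * n) a b c α β γ ε δ ζ ha.lt hb.lt hc.lt ha hb hc hαβ hαγ hβγ

theorem copy_ne_zero (h : IsDoublingSign n s) {a b c α β γ : ℕ} {ε δ ζ : ℝ} (ha : IsCopy n a α ε)
    (hb : IsCopy n b β δ) (hc : IsCopy n c γ ζ) (hαβ : α ≠ β) (hαγ : α ≠ γ) (hβγ : β ≠ γ) :
    s a b c ≠ 0 := by
  rw [h.copy ha hb hc hαβ hαγ hβγ]
  exact mul_ne_zero (mul_ne_zero (mul_ne_zero ha.sign_ne_zero hb.sign_ne_zero) hc.sign_ne_zero)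
    (h.ne_zero α β γ ha.1 hb.1 hc.1 hαβ hαγ hβγ)

theorem pair (h : IsDoublingSign n s) {k c γ : ℕ} {ζ : ℝ} (hk0 : k ≠ 0) (hk : k < n)
    (hc : IsCopy n c γ ζ) (hγ0 : γ ≠ 0) (hγk : γ ≠ k) :
    s k (n + k) c = ζ * s 0 k γ := by
  have low : ∀ c γ ζ, c < n + k → IsCopy n c γ ζ → γ ≠ 0 → γ ≠ k →
      s k (n + k) c = ζ * s 0 k γ := by
    intro c γ ζ hck hc hγ0 hγk
    have h0 : IsCopy n 0 0 1 := isCopy_self (by omega)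
    rw [← h.rotate c k (n + k), h.step_add hk0 hk hck (by omega), h.self_right,
      firstNonzero_zero_of_ne (h.copy_ne_zero hc (isCopy_self hk) h0 hγk hγ0 hk0),
      h.copy hc (isCopy_self hk) h0 hγk hγ0 hk0, h.rotate 0 k γ, h.swap k γ 0]
    ring
  by_cases hck : c < n + k
  · exact low c γ ζ hck hc hγ0 hγk
  · obtain ⟨rfl, rfl⟩ | ⟨rfl, rfl⟩ := hc.eq_or hγ0
    · exact absurd hc.1 (by omega)
    · have h1 := low γ γ 1 (by have := hc.1; omega) (isCopy_self hc.1) hγ0 hγk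
      rw [h.step_add hγ0 hc.1 (by omega) (by omega), firstNonzero_of_ne, h1]
      · ring
      · rw [h1, one_mul]
        exact h.ne_zero 0 k γ (by omega) hk hc.1 hk0.symm hγ0.symm hγk.symm

theorem zero_base_ne_zero (h : IsDoublingSign n s) (hn : 3 ≤ n) {k : ℕ} (hk0 : k ≠ 0)
    (hk : k < n) : s 0 n k ≠ 0 := by
  rw [← h.rotate k 0 n, h.step n le_rfl (by omega) k 0 hk (by omega), doublingRule, if_pos rfl,
    h.self_right]
  by_cases hk1 : k = 1
  · subst hk1
    rw [h.self_outer, firstNonzero_zero_zero]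
    exact h.ne_zero 1 0 2 (by omega) (by omega) (by omega) (by omega) (by omega) (by omega)
  · have := h.ne_zero k 0 1 hk (by omega) (by omega) hk0 hk1 (by omega)
    rwa [firstNonzero_zero_of_ne this]

theorem zero_base_add (h : IsDoublingSign n s) (hn : 3 ≤ n) {k : ℕ} (hk0 : k ≠ 0)
    (hk : k < n) : s 0 n (n + k) = -s 0 n k := by
  rw [h.step_add hk0 hk (by omega) (by omega), firstNonzero_of_ne (h.zero_base_ne_zero hn hk0 hk)]

theorem pair_zero (h : IsDoublingSign n s) {k : ℕ} (hk0 : k ≠ 0) (hk : k < n) :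
    s k (n + k) 0 = s 0 n k := by
  rw [← h.rotate 0 k, h.step_add hk0 hk (by omega) (by omega), h.self_right, h.self_outer,
    firstNonzero_zero_zero, h.swap_right 0 k n, neg_neg]

theorem pair_base (h : IsDoublingSign n s) (hn : 3 ≤ n) {k : ℕ} (hk0 : k ≠ 0) (hk : k < n) :
    s k (n + k) n = -s 0 n k := by
  have := h.zero_base_ne_zero hn hk0 hk
  rw [h.rotate] at this
  rw [← h.rotate n k, h.step_add hk0 hk (by omega) (by omega), h.self_right,
    firstNonzero_zero_of_ne this, h.rotate 0 n k]

theorem isUniform (h : IsDoublingSign n s) (hn : 3 ≤ n) {a b c : ℕ} (ha : a < 2 * n)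
    (hb : b < 2 * n) (hc : c < 2 * n) (hab : a ≠ b) (hac : a ≠ c) (hbc : b ≠ c) :
    s a b c ≠ 0 := by
  have hpair : ∀ k c, k < n → c < 2 * n → c ≠ k → c ≠ n + k → s k (n + k) c ≠ 0 := by
    intro k c hk hc hck hcnk
    obtain ⟨γ, ζ, hγ⟩ := exists_isCopy (n := n) (by omega) hc
    by_cases hk0 : k = 0
    · subst hk0
      rw [add_zero] at hcnk ⊢
      have hγ0 : γ ≠ 0 := by
        have := hγ.2
        omega
      obtain ⟨rfl, -⟩ | ⟨rfl, -⟩ := hγ.eq_or hγ0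
      · exact h.zero_base_ne_zero hn hγ0 hγ.1
      · rw [h.zero_base_add hn hγ0 hγ.1]
        exact neg_ne_zero.mpr (h.zero_base_ne_zero hn hγ0 hγ.1)
    have hγk : γ ≠ k := by
      have := hγ.2
      omega
    by_cases hγ0 : γ = 0
    · subst hγ0
      obtain ⟨-, ⟨rfl, -⟩ | ⟨rfl, -⟩ | ⟨-, h', -⟩⟩ := hγ
      · rw [h.pair_zero hk0 hk]
        exact h.zero_base_ne_zero hn hk0 hk
      · rw [h.pair_base hn hk0 hk]
        exact neg_ne_zero.mpr (h.zero_base_ne_zero hn hk0 hk)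
      · exact absurd rfl h'
    · rw [h.pair hk0 hk hγ hγ0 hγk]
      exact mul_ne_zero hγ.sign_ne_zero
        (h.ne_zero 0 k γ (by omega) hk hγ.1 (Ne.symm hk0) (Ne.symm hγ0) hγk.symm)
  have hsame : ∀ a b c α ε δ, IsCopy n a α ε → IsCopy n b α δ → c < 2 * n → a ≠ b → a ≠ c →
      b ≠ c → s a b c ≠ 0 := by
    intro a b c α ε δ ha hb hc hab hac hbc
    have h1 := ha.2
    have h2 := hb.2
    have : (a = α ∧ b = n + α) ∨ (a = n + α ∧ b = α) := by omega
    obtain ⟨rfl, rfl⟩ | ⟨rfl, rfl⟩ := this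
    · exact hpair a c ha.1 hc hac.symm hbc.symm
    · rw [h.swap, neg_ne_zero]
      exact hpair b c ha.1 hc hbc.symm hac.symm
  obtain ⟨α, ε, hα⟩ := exists_isCopy (n := n) (by omega) ha
  obtain ⟨β, δ, hβ⟩ := exists_isCopy (n := n) (by omega) hb
  obtain ⟨γ, ζ, hγ⟩ := exists_isCopy (n := n) (by omega) hc
  by_cases hαβ : α = β
  · subst hαβ
    exact hsame a b c α ε δ hα hβ hc hab hac hbc
  by_cases hβγ : β = γ
  · subst hβγ
    rw [h.rotate]
    exact hsame b c a β δ ζ hβ hγ ha hbc hab.symm hac.symm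
  by_cases hαγ : α = γ
  · subst hαγ
    rw [← h.rotate]
    exact hsame c a b α ζ ε hγ hα hb hac.symm hbc.symm hab
  exact h.copy_ne_zero hα hβ hγ hαβ hαγ hβγ

theorem add_eq_zero (h : IsDoublingSign n s) {a b α β k : ℕ} {ε δ : ℝ}
    (ha : IsCopy n a α ε) (hb : IsCopy n b β δ) (hαβ : α ≠ β) (hk : k < n) (hk0 : k ≠ 0)
    (hkα : k ≠ α) (hkβ : k ≠ β) : s a b k + s a b (n + k) = 0 := by
  rw [h.copy ha hb (isCopy_self hk) hαβ hkα.symm hkβ.symm,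
    h.copy ha hb (isCopy_add hk hk0) hαβ hkα.symm hkβ.symm]
  ring

theorem add_left (h : IsDoublingSign n s) {a b α β : ℕ} {ε δ : ℝ}
    (ha : IsCopy n a α ε) (hb : IsCopy n b β δ) (hαβ : α ≠ β) (hα0 : α ≠ 0) (hβ0 : β ≠ 0) :
    s a b α + s a b (n + α) = -(ε * δ * s α β 0) := by
  have h1 := h.pair hα0 ha.1 hb hβ0 hαβ.symm
  rw [h.rotate 0 α β] at h1
  obtain ⟨rfl, rfl⟩ | ⟨rfl, rfl⟩ := ha.eq_or hα0
  · rw [h.self_outer, h.swap_right, h1]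
    ring
  · rw [h.self_outer, ← h.rotate α, h1]
    ring

theorem sum_eq_zero (h : IsDoublingSign n s) (hn : 3 ≤ n) {a b : ℕ} (ha : a < 2 * n)
    (hb : b < 2 * n) : ∑ c ∈ Finset.range (2 * n), s a b c = 0 := by
  by_cases hab : a = b
  · subst hab
    exact Finset.sum_eq_zero fun c _ => h.self_left a c
  have hsplit : ∀ a b, ∑ c ∈ Finset.range (2 * n), s a b c =
      ∑ k ∈ Finset.range n, (s a b k + s a b (n + k)) := by
    intro a b
    rw [two_mul, Finset.sum_range_add, Finset.sum_add_distrib]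
  have hanti : ∀ a b, ∑ c ∈ Finset.range (2 * n), s a b c =
      -∑ c ∈ Finset.range (2 * n), s b a c := by
    intro a b
    rw [← Finset.sum_neg_distrib]
    exact Finset.sum_congr rfl fun c _ => h.swap a b c
  obtain ⟨α, ε, hα⟩ := exists_isCopy (n := n) (by omega) ha
  obtain ⟨β, δ, hβ⟩ := exists_isCopy (n := n) (by omega) hb
  by_cases hαβ : α = β
  · subst hαβ
    have hmain : ∑ c ∈ Finset.range (2 * n), s α (n + α) c = 0 := by
      rw [hsplit]
      refine Finset.sum_eq_zero fun k hk => ?_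
      rw [Finset.mem_range] at hk
      by_cases hkα : k = α
      · subst hkα
        rw [h.self_outer, h.self_right, add_zero]
      by_cases hα0 : α = 0
      · subst hα0
        rw [add_zero, h.zero_base_add hn hkα hk, add_neg_cancel]
      by_cases hk0 : k = 0
      · subst hk0
        rw [add_zero, h.pair_zero hα0 hα.1, h.pair_base hn hα0 hα.1, add_neg_cancel]
      · rw [h.pair hα0 hα.1 (isCopy_self hk) hk0 hkα, h.pair hα0 hα.1 (isCopy_add hk hk0) hk0 hkα]
        ring
    have h1 := hα.2
    have h2 := hβ.2
    have : (a = α ∧ b = n + α) ∨ (a = n + α ∧ b = α) := by omega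
    obtain ⟨rfl, rfl⟩ | ⟨rfl, rfl⟩ := this
    · exact hmain
    · rw [hanti, hmain, neg_zero]
  have hzero : ∀ a b β ε δ, IsCopy n a 0 ε → IsCopy n b β δ → 0 ≠ β →
      ∑ c ∈ Finset.range (2 * n), s a b c = 0 := by
    intro a b β ε δ ha hb hβ
    rw [hsplit, Finset.sum_eq_add_of_mem 0 β (by simp; omega) (by simpa using hb.1) hβ]
    · have hβ0 := hβ.symm
      have h1 := h.pair_zero hβ0 hb.1
      have h2 := h.pair_base hn hβ0 hb.1
      have h3 := h.zero_base_add hn hβ0 hb.1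
      rw [add_zero]
      obtain ⟨-, ⟨rfl, -⟩ | ⟨rfl, -⟩ | ⟨-, h', -⟩⟩ := ha
      · obtain ⟨rfl, -⟩ | ⟨rfl, -⟩ := hb.eq_or hβ0
        · linarith [h.self_outer 0 b, h.self_right 0 b, h.swap_right 0 b n, h.rotate 0 b (n + b)]
        · linarith [h.self_outer 0 (n + β), h.self_right 0 (n + β), h.swap_right 0 (n + β) n,
            h.swap_right 0 (n + β) β, h.rotate 0 β (n + β)]
      · obtain ⟨rfl, -⟩ | ⟨rfl, -⟩ := hb.eq_or hβ0
        · linarith [h.self_outer a b, h.self_right a b, h.rotate 0 a b, h.rotate a b (a + b)]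
        · linarith [h.self_outer a (a + β), h.self_right a (a + β), h.rotate 0 a (a + β),
            h.swap_right a (a + β) β, h.rotate a β (a + β)]
      · exact absurd rfl h'
    · intro k hk hk'
      exact h.add_eq_zero ha hb hβ (Finset.mem_range.mp hk) hk'.1 hk'.1 hk'.2
  by_cases hα0 : α = 0
  · subst hα0
    exact hzero a b β ε δ hα hβ hαβ
  by_cases hβ0 : β = 0
  · subst hβ0
    rw [hanti, hzero b a α δ ε hβ hα (Ne.symm hα0), neg_zero]
  have h1 := h.add_left hα hβ hαβ hα0 hβ0
  have h2 := h.add_left hβ hα (Ne.symm hαβ) hβ0 hα0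
  have h3 := h.copy hα hβ (isCopy_self (n := n) (a := 0) (by omega)) hαβ hα0 hβ0
  have h4 := h.copy hα hβ (isCopy_zero (n := n) (by omega)) hαβ hα0 hβ0
  have hsub : ({0, α, β} : Finset ℕ) ⊆ Finset.range n := by
    intro k hk
    simp only [Finset.mem_insert, Finset.mem_singleton] at hk
    rw [Finset.mem_range]
    rcases hk with rfl | rfl | rfl
    · omega
    · exact hα.1
    · exact hβ.1
  rw [hsplit, ← Finset.sum_subset hsub]
  · rw [Finset.sum_insert (by simp; omega), Finset.sum_insert (by simpa using hαβ),
      Finset.sum_singleton, h1, add_zero, h3, h4, h.swap a b β, h.swap a b (n + β), ← neg_add, h2,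
      h.swap β α]
    ring
  · intro k hk hk'
    simp only [Finset.mem_insert, Finset.mem_singleton, not_or] at hk'
    exact h.add_eq_zero hα hβ hαβ (Finset.mem_range.mp hk) hk'.1 hk'.2.1 hk'.2.2

end IsDoublingSign

end DoublingSigns

section Doubling

open scoped Topology

theorem eventually_sign_eq {f : ℝ → ℝ} (hf : Continuous f) (h : f 0 ≠ 0) :
    ∀ᶠ ε in 𝓝[>] (0 : ℝ), Real.sign (f ε) = Real.sign (f 0) := by
  have ht : Filter.Tendsto f (𝓝[>] 0) (𝓝 (f 0)) :=
    (hf.tendsto 0).mono_left nhdsWithin_le_nhds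
  rcases h.lt_or_gt with h | h
  · filter_upwards [ht.eventually_lt_const h] with ε hε
    rw [Real.sign_of_neg hε, Real.sign_of_neg h]
  · filter_upwards [ht.eventually_const_lt h] with ε hε
    rw [Real.sign_of_pos hε, Real.sign_of_pos h]

theorem sign_mul_of_pos {t : ℝ} (ht : 0 < t) (x : ℝ) : Real.sign (t * x) = Real.sign x := by
  rcases lt_trichotomy x 0 with h | rfl | h
  · rw [Real.sign_of_neg h, Real.sign_of_neg (mul_neg_of_pos_of_neg ht h)]
  · rw [mul_zero]
  · rw [Real.sign_of_pos h, Real.sign_of_pos (mul_pos ht h)]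

theorem exists_pos_sign_eq_firstNonzero {ι : Type*} [Finite ι] (A B C : ι → ℝ) :
    ∃ ε : ℝ, 0 < ε ∧ ∀ i, Real.sign (A i + ε * B i + ε ^ 2 * C i) =
      firstNonzero (Real.sign (A i)) (Real.sign (B i)) (Real.sign (C i)) := by
  have key : ∀ᶠ ε in 𝓝[>] (0 : ℝ), ∀ i, Real.sign (A i + ε * B i + ε ^ 2 * C i) =
      firstNonzero (Real.sign (A i)) (Real.sign (B i)) (Real.sign (C i)) := by
    rw [Filter.eventually_all]
    intro i
    by_cases hA : A i = 0
    · by_cases hB : B i = 0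
      · filter_upwards [self_mem_nhdsWithin] with ε hε
        rw [hA, hB, Real.sign_zero, firstNonzero_zero_zero, mul_zero, add_zero, zero_add,
          sign_mul_of_pos (pow_pos hε 2)]
      · have h := eventually_sign_eq (f := fun ε => B i + ε * C i) (by fun_prop) (by simpa using hB)
        filter_upwards [h, self_mem_nhdsWithin] with ε h hε
        rw [hA, Real.sign_zero, firstNonzero_zero_of_ne (Real.sign_eq_zero_iff.not.mpr hB), zero_add,
          pow_two, mul_assoc, ← mul_add, sign_mul_of_pos hε, h, zero_mul, add_zero]
    · have h := eventually_sign_eq (f := fun ε => A i + ε * B i + ε ^ 2 * C i) (by fun_prop)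
        (by simpa using hA)
      filter_upwards [h] with ε h
      rw [firstNonzero_of_ne (Real.sign_eq_zero_iff.not.mpr hA), h]
      simp
  obtain ⟨ε, h, hε⟩ := (key.and self_mem_nhdsWithin).exists
  exact ⟨ε, hε, h⟩

/-- The signs of the determinants of a sequence of vectors. -/
def detSign (W : ℕ → Fin 3 → ℝ) (a b c : ℕ) : ℝ := Real.sign (det3 (W a) (W b) (W c))

theorem exists_sign_eq_doublingRule (n m : ℕ) (W : ℕ → Fin 3 → ℝ) :
    ∃ x : Fin 3 → ℝ, ∀ a b, a < m → b < m →
      Real.sign (det3 (W a) (W b) x) = doublingRule n m (detSign W) a b := by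
  have hcomb : ∀ p q r, ∃ x : Fin 3 → ℝ, ∀ a b, a < m → b < m →
      Real.sign (det3 (W a) (W b) x) =
        firstNonzero (detSign W a b p) (detSign W a b q) (detSign W a b r) := by
    intro p q r
    obtain ⟨ε, -, h⟩ := exists_pos_sign_eq_firstNonzero
      (fun i : Fin m × Fin m => det3 (W i.1) (W i.2) (W p))
      (fun i => det3 (W i.1) (W i.2) (W q)) (fun i => det3 (W i.1) (W i.2) (W r))
    refine ⟨W p + ε • W q + ε ^ 2 • W r, fun a b ha hb => ?_⟩
    have := h (⟨a, ha⟩, ⟨b, hb⟩)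
    simp only at this
    rw [detSign, detSign, detSign, ← this]
    congr 1
    simp only [det3, Pi.add_apply, Pi.smul_apply, smul_eq_mul]
    ring
  by_cases hm : m = n
  · obtain ⟨x, hx⟩ := hcomb 0 1 2
    exact ⟨x, fun a b ha hb => by rw [hx a b ha hb, doublingRule, if_pos hm]⟩
  · obtain ⟨x, hx⟩ := hcomb (m - n) 0 n
    refine ⟨-x, fun a b ha hb => ?_⟩
    rw [doublingRule, if_neg hm, ← hx a b ha hb, ← Real.sign_neg]
    congr 1
    simp only [det3, Pi.neg_apply]
    ring

theorem doublingRule_congr {n m : ℕ} (hn : 3 ≤ n) (hm : n ≤ m) (hm' : m < 2 * n)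
    {s t : ℕ → ℕ → ℕ → ℝ} {a b : ℕ} (h : ∀ c < m, s a b c = t a b c) :
    doublingRule n m s a b = doublingRule n m t a b := by
  unfold doublingRule
  split_ifs with h1
  · rw [h 0 (by omega), h 1 (by omega), h 2 (by omega)]
  · rw [h (m - n) (by omega), h 0 (by omega), h n (by omega)]

theorem exists_isDoublingSign {n : ℕ} (hn : 3 ≤ n) (v : ℕ → Fin 3 → ℝ)
    (hv : ∀ a b c, a < n → b < n → c < n → a ≠ b → a ≠ c → b ≠ c →
      det3 (v a) (v b) (v c) ≠ 0) :
    ∃ W : ℕ → Fin 3 → ℝ, (∀ i < n, W i = v i) ∧ IsDoublingSign n (detSign W) := by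
  have key : ∀ k, k ≤ n → ∃ W : ℕ → Fin 3 → ℝ, (∀ i < n, W i = v i) ∧
      ∀ m, n ≤ m → m < n + k → ∀ a b, a < m → b < m →
        detSign W a b m = doublingRule n m (detSign W) a b := by
    intro k
    induction k with
    | zero => exact fun _ => ⟨v, fun _ _ => rfl, fun m h1 h2 => by omega⟩
    | succ k ih =>
      intro hk
      obtain ⟨W, hW, hstep⟩ := ih (by omega)
      obtain ⟨x, hx⟩ := exists_sign_eq_doublingRule n (n + k) W
      have hlow : ∀ i < n + k, Function.update W (n + k) x i = W i := fun i hi =>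
        Function.update_of_ne hi.ne _ _
      have hsign : ∀ a b c, a < n + k → b < n + k → c < n + k →
          detSign (Function.update W (n + k) x) a b c = detSign W a b c := by
        intro a b c ha hb hc
        simp only [detSign, hlow a ha, hlow b hb, hlow c hc]
      refine ⟨Function.update W (n + k) x, fun i hi => ?_, fun m hm hm' a b ha hb => ?_⟩
      · rw [hlow i (by omega), hW i hi]
      · rw [doublingRule_congr hn hm (by omega)
          fun c hc => hsign a b c (by omega) (by omega) (by omega)]
        by_cases hmk : m = n + k
        · subst hmk
          rw [detSign, hlow a ha, hlow b hb, Function.update_self, hx a b ha hb]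
        · rw [hsign a b m (by omega) (by omega) (by omega), hstep m hm (by omega) a b ha hb]
  obtain ⟨W, hW, hstep⟩ := key n le_rfl
  refine ⟨W, hW, ?_, ?_, ?_, ?_⟩
  · intro a b c
    rw [detSign, detSign, det3_swap, Real.sign_neg]
  · intro a b c
    rw [detSign, detSign, det3_rotate]
  · intro a b c ha hb hc hab hac hbc
    rw [detSign, Ne, Real.sign_eq_zero_iff, hW a ha, hW b hb, hW c hc]
    exact hv a b c ha hb hc hab hac hbc
  · intro m hm hm' a b ha hb
    exact hstep m hm (by omega) a b ha hb

end Doubling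

section StableProjections

open scoped Matrix

theorem IsStableProjection.of_fintype {d d' : ℕ} {S : Set (Fin d → ℝ)}
    {T : Set (Fin (d + d') → ℝ)} {K L : Type*} [Fintype K] [Fintype L]
    (A : K → Fin d' → MvPolynomial (Fin d) ℝ) (b : K → MvPolynomial (Fin d) ℝ)
    (C : L → Fin d' → MvPolynomial (Fin d) ℝ) (c : L → MvPolynomial (Fin d) ℝ)
    (hne : ∀ x ∈ S, ∃ y : Fin d' → ℝ, Fin.append x y ∈ T)
    (hT : ∀ (x : Fin d → ℝ) (y : Fin d' → ℝ), Fin.append x y ∈ T ↔ x ∈ S ∧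
      (∀ i, (∑ j, MvPolynomial.eval x (A i j) * y j) + MvPolynomial.eval x (b i) = 0) ∧
      (∀ i, 0 < (∑ j, MvPolynomial.eval x (C i j) * y j) + MvPolynomial.eval x (c i))) :
    IsStableProjection S T := by
  refine ⟨Fintype.card K, Fintype.card L, fun i => A ((Fintype.equivFin K).symm i),
    fun i => b ((Fintype.equivFin K).symm i), fun i => C ((Fintype.equivFin L).symm i),
    fun i => c ((Fintype.equivFin L).symm i), hne, fun x y => ?_⟩
  rw [hT]
  refine and_congr_right fun _ => and_congr ?_ ?_
  · exact ((Fintype.equivFin K).symm.forall_congr_right (q := fun i =>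
      (∑ j, MvPolynomial.eval x (A i j) * y j) + MvPolynomial.eval x (b i) = 0)).symm
  · exact ((Fintype.equivFin L).symm.forall_congr_right (q := fun i =>
      0 < (∑ j, MvPolynomial.eval x (C i j) * y j) + MvPolynomial.eval x (c i))).symm

/-- The point configuration with the given list of coordinates. -/
def unflatten {n d : ℕ} (x : Fin (d * n) → ℝ) (p : Fin n) (c : Fin d) : ℝ := x (flatIdx p c)

theorem mem_flat {n d : ℕ} {R : Set (Fin n → Fin d → ℝ)} {x : Fin (d * n) → ℝ} :
    x ∈ flat R ↔ unflatten x ∈ R := Iff.rfl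

theorem unflatten_append {n d : ℕ} (x : Fin (d * n) → ℝ) (y : Fin d → ℝ) :
    unflatten (n := n + 1) (Fin.append x y) = Fin.snoc (α := fun _ => Fin d → ℝ) (unflatten x) y := by
  ext p c
  refine Fin.lastCases ?_ (fun p => ?_) p
  · rw [Fin.snoc_last, unflatten]
    exact Fin.append_right x y c
  · rw [Fin.snoc_castSucc, unflatten, unflatten]
    exact Fin.append_left x y (flatIdx p c)

/-- The configurations of `m` vectors in `ℝ³` with orientations given by `s`, normalized so that
the first three vectors are the standard basis. -/
def signRealizationSpace (s : ℕ → ℕ → ℕ → ℝ) (m : ℕ) : Set (Fin m → Fin 3 → ℝ) :=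
  {W | (∀ (i : Fin m) (a : Fin 3), (i : ℕ) = a → W i = Pi.single a 1) ∧
    ∀ i j k : Fin m, i ≠ j → i ≠ k → j ≠ k → Real.sign (det3 (W i) (W j) (W k)) = s i j k}

theorem snoc_mem_signRealizationSpace {n m : ℕ} {s : ℕ → ℕ → ℕ → ℝ} (h : IsDoublingSign n s)
    (hm : 3 ≤ m) (W : Fin m → Fin 3 → ℝ) (y : Fin 3 → ℝ) :
    Fin.snoc (α := fun _ => Fin 3 → ℝ) W y ∈ signRealizationSpace s (m + 1) ↔
      W ∈ signRealizationSpace s m ∧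
        ∀ a b : Fin m, a ≠ b → Real.sign (det3 (W a) (W b) y) = s a b m := by
  constructor
  · rintro ⟨h1, h2⟩
    refine ⟨⟨fun i a hi => ?_, fun i j k hij hik hjk => ?_⟩, fun a b hab => ?_⟩
    · have := h1 i.castSucc a (by simpa using hi)
      rwa [Fin.snoc_castSucc] at this
    · have := h2 i.castSucc j.castSucc k.castSucc (by simpa using hij) (by simpa using hik)
        (by simpa using hjk)
      simpa only [Fin.snoc_castSucc, Fin.val_castSucc] using this
    · have := h2 a.castSucc b.castSucc (Fin.last m) (by simpa using hab)
        (Fin.castSucc_lt_last a).ne (Fin.castSucc_lt_last b).ne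
      simpa only [Fin.snoc_castSucc, Fin.snoc_last, Fin.val_castSucc, Fin.val_last] using this
  · rintro ⟨⟨h1, h2⟩, h3⟩
    refine ⟨fun i a hi => ?_, fun i j k hij hik hjk => ?_⟩
    · induction i using Fin.lastCases with
      | last =>
        simp only [Fin.val_last] at hi
        omega
      | cast i => rw [Fin.snoc_castSucc, h1 i a (by simpa using hi)]
    · induction i using Fin.lastCases with
      | last =>
        induction j using Fin.lastCases with
        | last => exact absurd rfl hij
        | cast j =>
          induction k using Fin.lastCases with
          | last => exact absurd rfl hik
          | cast k =>
            rw [det3_rotate, h.rotate]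
            simpa only [Fin.snoc_castSucc, Fin.snoc_last, Fin.val_castSucc, Fin.val_last] using
              h3 j k (by simpa using hjk)
      | cast i =>
        induction j using Fin.lastCases with
        | last =>
          induction k using Fin.lastCases with
          | last => exact absurd rfl hjk
          | cast k =>
            rw [← det3_rotate, ← h.rotate]
            simpa only [Fin.snoc_castSucc, Fin.snoc_last, Fin.val_castSucc, Fin.val_last] using
              h3 k i (by simpa using hik.symm)
        | cast j =>
          induction k using Fin.lastCases with
          | last =>
            simpa only [Fin.snoc_castSucc, Fin.snoc_last, Fin.val_castSucc, Fin.val_last] using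
              h3 i j (by simpa using hij)
          | cast k =>
            simpa only [Fin.snoc_castSucc, Fin.snoc_last, Fin.val_castSucc, Fin.val_last] using
              h2 i j k (by simpa using hij) (by simpa using hik) (by simpa using hjk)

theorem sign_eq_sign_iff {t x : ℝ} (ht : Real.sign t ≠ 0) :
    Real.sign x = Real.sign t ↔ 0 < Real.sign t * x := by
  rw [Ne, Real.sign_eq_zero_iff] at ht
  rcases lt_or_gt_of_ne ht with h | h
  · rw [Real.sign_of_neg h]
    rcases lt_trichotomy x 0 with hx | rfl | hx
    · simp [Real.sign_of_neg hx, hx]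
    · simp
    · simp only [Real.sign_of_pos hx]
      constructor <;> intro <;> linarith
  · rw [Real.sign_of_pos h]
    rcases lt_trichotomy x 0 with hx | rfl | hx
    · simp only [Real.sign_of_neg hx]
      constructor <;> intro <;> linarith
    · simp
    · simp [Real.sign_of_pos hx, hx]

theorem signRealizationSpace_nonempty_fiber {n m : ℕ} (hn : 3 ≤ n) {s : ℕ → ℕ → ℕ → ℝ}
    (h : IsDoublingSign n s) (hm : n ≤ m) (hm' : m < 2 * n) {W : Fin m → Fin 3 → ℝ}
    (hW : W ∈ signRealizationSpace s m) :
    ∃ y : Fin 3 → ℝ, ∀ a b : Fin m, a ≠ b → Real.sign (det3 (W a) (W b) y) = s a b m := by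
  obtain ⟨y, hy⟩ := exists_sign_eq_doublingRule n m
    (fun i => if hi : i < m then W ⟨i, hi⟩ else 0)
  refine ⟨y, fun a b hab => ?_⟩
  have h1 := hy a b a.2 b.2
  simp only [a.2, b.2, dif_pos] at h1
  rw [h1, h.step m hm hm' a b a.2 b.2]
  refine doublingRule_congr hn hm hm' fun c hc => ?_
  simp only [detSign, a.2, b.2, hc, dif_pos]
  by_cases hca : c = a
  · simp only [hca, det3_self_outer, Real.sign_zero, h.self_outer]
  by_cases hcb : c = b
  · simp only [hcb, det3_self_right, Real.sign_zero, h.self_right]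
  exact hW.2 a b ⟨c, hc⟩ hab (fun h' => hca (by rw [h'])) (fun h' => hcb (by rw [h']))

theorem isStableProjection_signRealizationSpace {n m : ℕ} (hn : 3 ≤ n) {W₀ : ℕ → Fin 3 → ℝ}
    (h : IsDoublingSign n (detSign W₀)) (hm : n ≤ m) (hm' : m < 2 * n) :
    IsStableProjection (d := 3 * m) (d' := 3) (flat (signRealizationSpace (detSign W₀) m))
      (flat (n := m + 1) (signRealizationSpace (detSign W₀) (m + 1))) := by
  have hmem : ∀ (x : Fin (3 * m) → ℝ) (y : Fin 3 → ℝ),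
      Fin.append x y ∈ flat (n := m + 1) (signRealizationSpace (detSign W₀) (m + 1)) ↔
        x ∈ flat (signRealizationSpace (detSign W₀) m) ∧ ∀ a b : Fin m, a ≠ b →
          Real.sign (det3 (unflatten x a) (unflatten x b) y) = detSign W₀ a b m := by
    intro x y
    rw [mem_flat, mem_flat, unflatten_append, snoc_mem_signRealizationSpace h (by omega)]
  refine .of_fintype (K := Empty) (L := {p : Fin m × Fin m // p.1 ≠ p.2}) (fun i => i.elim)
    (fun i => i.elim)
    (fun p j => MvPolynomial.C (detSign W₀ p.1.1 p.1.2 m) *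
      ((fun c => MvPolynomial.X (flatIdx p.1.1 c)) ⨯₃
        (fun c => MvPolynomial.X (flatIdx p.1.2 c)) : Fin 3 → MvPolynomial (Fin (3 * m)) ℝ) j)
    (fun _ => 0) (fun x hx => ?_) (fun x y => ?_)
  · obtain ⟨y, hy⟩ := signRealizationSpace_nonempty_fiber hn h hm hm' (mem_flat.mp hx)
    exact ⟨y, (hmem x y).mpr ⟨hx, hy⟩⟩
  · rw [hmem]
    refine and_congr_right fun _ => ?_
    simp only [IsEmpty.forall_iff, true_and, map_zero, add_zero, Subtype.forall, Prod.forall]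
    refine forall_congr' fun a => forall_congr' fun b => forall_congr' fun hab => ?_
    have hne : detSign W₀ a b m ≠ 0 := h.isUniform hn (by omega) (by omega) hm'
      (fun h' => hab (Fin.ext h')) a.2.ne b.2.ne
    rw [detSign, sign_eq_sign_iff hne]
    refine iff_of_eq (congrArg (0 < ·) ?_)
    simp only [det3, unflatten, cross_apply, Fin.sum_univ_three, Matrix.cons_val, map_mul, map_sub,
      MvPolynomial.eval_C, MvPolynomial.eval_X]
    ring

/-- The set of points of `S` together with positive weights satisfying a system of linear
equations. -/
def weightSpace {D N k : ℕ} (S : Set (Fin D → ℝ)) (A : Fin k → Fin N → MvPolynomial (Fin D) ℝ) :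
    Set (Fin (D + N) → ℝ) :=
  {z | (fun i => z (Fin.castAdd N i)) ∈ S ∧
    (∀ i, ∑ j, MvPolynomial.eval (fun i => z (Fin.castAdd N i)) (A i j) * z (Fin.natAdd D j) = 0) ∧
    ∀ j, 0 < z (Fin.natAdd D j)}

theorem isStableProjection_weightSpace {D N k : ℕ} (S : Set (Fin D → ℝ))
    (A : Fin k → Fin N → MvPolynomial (Fin D) ℝ)
    (h : ∀ x ∈ S, ∃ c : Fin N → ℝ, (∀ i, ∑ j, MvPolynomial.eval x (A i j) * c j = 0) ∧
      ∀ j, 0 < c j) :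
    IsStableProjection S (weightSpace S A) := by
  have hmem : ∀ x y, Fin.append x y ∈ weightSpace S A ↔ x ∈ S ∧
      (∀ i, ∑ j, MvPolynomial.eval x (A i j) * y j = 0) ∧ ∀ j, 0 < y j := by
    intro x y
    simp only [weightSpace, Set.mem_ofPred_eq, Fin.append_left, Fin.append_right]
  refine .of_fintype A 0 (fun i j : Fin N => if i = j then 1 else 0) 0 (fun x hx => ?_)
    (fun x y => ?_)
  · obtain ⟨c, hc⟩ := h x hx
    exact ⟨c, (hmem x c).mpr ⟨hx, hc⟩⟩
  · rw [hmem]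
    simp [apply_ite (MvPolynomial.eval x)]

end StableProjections

section Faces

open scoped Matrix

variable {n d : ℕ}

theorem nonneg_on_convexHull {x : Fin n → Fin d → ℝ} {α : ℝ} {β : Fin d → ℝ}
    (h : ∀ i, 0 ≤ α + β ⬝ᵥ x i) {p : Fin d → ℝ} (hp : p ∈ convexHull ℝ (Set.range x)) :
    0 ≤ α + β ⬝ᵥ p := by
  have hconv : Convex ℝ {p : Fin d → ℝ | -α ≤ β ⬝ᵥ p} :=
    convex_halfSpace_ge (f := fun p => β ⬝ᵥ p)
      ⟨fun p q => dotProduct_add β p q, fun c p => dotProduct_smul c β p⟩ _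
  have hsub : Set.range x ⊆ {p : Fin d → ℝ | -α ≤ β ⬝ᵥ p} := by
    rintro _ ⟨i, rfl⟩
    have := h i
    simp only [Set.mem_ofPred_eq]
    linarith
  have := convexHull_min hsub hconv hp
  simp only [Set.mem_ofPred_eq] at this
  linarith

theorem isExposed_zeroSet {x : Fin n → Fin d → ℝ} {α : ℝ} {β : Fin d → ℝ}
    (h : ∀ i, 0 ≤ α + β ⬝ᵥ x i) :
    IsExposed ℝ (convexHull ℝ (Set.range x)) {p ∈ convexHull ℝ (Set.range x) | α + β ⬝ᵥ p = 0} := by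
  rintro ⟨p₀, hp₀, hp₀'⟩
  refine ⟨LinearMap.toContinuousLinearMap (-(dotProductBilin ℝ ℝ β)), ?_⟩
  ext p
  simp only [Set.mem_ofPred_eq, LinearMap.coe_toContinuousLinearMap', LinearMap.neg_apply,
    dotProductBilin_apply_apply]
  refine and_congr_right fun hp => ⟨fun h0 y hy => ?_, fun hmax => ?_⟩
  · have := nonneg_on_convexHull h hy
    linarith
  · have h1 := hmax p₀ hp₀
    have h2 := nonneg_on_convexHull h hp
    linarith

theorem exists_eq_of_mem_extremePoints_zeroSet {x : Fin n → Fin d → ℝ} {α : ℝ} {β : Fin d → ℝ}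
    (h : ∀ i, 0 ≤ α + β ⬝ᵥ x i) {p : Fin d → ℝ}
    (hp : p ∈ Set.extremePoints ℝ {p ∈ convexHull ℝ (Set.range x) | α + β ⬝ᵥ p = 0}) :
    ∃ i, x i = p ∧ α + β ⬝ᵥ x i = 0 ∧ x i ∈ Set.extremePoints ℝ (convexHull ℝ (Set.range x)) := by
  have hext := (isExposed_zeroSet h).isExtreme.extremePoints_subset_extremePoints hp
  obtain ⟨i, rfl⟩ := extremePoints_convexHull_subset hext
  exact ⟨i, rfl, hp.1.2, hext⟩

theorem mem_extremePoints_of_zeroSet {x : Fin n → Fin d → ℝ} {α : ℝ} {β : Fin d → ℝ} {i : Fin n}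
    (hi : α + β ⬝ᵥ x i = 0) (h : ∀ j, j ≠ i → 0 < α + β ⬝ᵥ x j) :
    x i ∈ Set.extremePoints ℝ (convexHull ℝ (Set.range x)) := by
  have hnonneg : ∀ j, 0 ≤ α + β ⬝ᵥ x j := fun j => by
    by_cases hj : j = i
    · rw [hj, hi]
    · exact (h j hj).le
  have hcompact := (isExposed_zeroSet hnonneg).isCompact
    ((Set.finite_range x).isCompact_convexHull (𝕜 := ℝ))
  obtain ⟨p, hp⟩ := hcompact.extremePoints_nonempty
    ⟨x i, subset_convexHull ℝ _ (Set.mem_range_self i), hi⟩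
  obtain ⟨j, -, hj, hext⟩ := exists_eq_of_mem_extremePoints_zeroSet hnonneg hp
  by_cases hji : j = i
  · exact hji ▸ hext
  · exact absurd hj (h j hji).ne'

theorem isVertexSetOfFace_iff {x : Fin n → Fin d → ℝ} (hinj : Function.Injective x)
    (hext : ∀ i, x i ∈ Set.extremePoints ℝ (convexHull ℝ (Set.range x))) (S : Finset (Fin n)) :
    IsVertexSetOfFace x S ↔ ∃ (α : ℝ) (β : Fin d → ℝ),
      (∀ i ∈ S, α + β ⬝ᵥ x i = 0) ∧ ∀ i ∉ S, 0 < α + β ⬝ᵥ x i := by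
  constructor
  · rintro ⟨F, hF | hF, hFS⟩
    · refine ⟨0, 0, fun i _ => by simp, fun i hi => ?_⟩
      have hmem : x i ∈ x '' (S : Set (Fin n)) := hFS ▸ hF ▸ hext i
      exact absurd (hinj.mem_set_image.mp hmem) hi
    · rcases F.eq_empty_or_nonempty with rfl | ⟨p₀, hp₀⟩
      · rw [extremePoints_empty, eq_comm, Set.image_eq_empty, Finset.coe_eq_empty] at hFS
        exact ⟨1, 0, by simp [hFS], by simp⟩
      · have hsub := hF.subset
        obtain ⟨l, hl⟩ := hF ⟨p₀, hp₀⟩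
        have hlp : ∀ p : Fin d → ℝ, (fun c => -l (Pi.single c 1)) ⬝ᵥ p = -l p := by
          intro p
          have := LinearMap.pi_apply_eq_sum_univ (l : (Fin d → ℝ) →ₗ[ℝ] ℝ) p
          simp only [ContinuousLinearMap.coe_coe, smul_eq_mul] at this
          rw [this, dotProduct, ← Finset.sum_neg_distrib]
          refine Finset.sum_congr rfl fun c _ => ?_
          have : (Pi.single c 1 : Fin d → ℝ) = fun j => if c = j then 1 else 0 := by
            ext j
            simp [Pi.single_apply, eq_comm]
          rw [this]
          ring
        have hp₀' := hl ▸ hp₀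
        refine ⟨l p₀, fun c => -l (Pi.single c 1), fun i hi => ?_, fun i hi => ?_⟩
        · have hmem : x i ∈ Set.extremePoints ℝ F := hFS ▸ Set.mem_image_of_mem x hi
          have hiF := hl ▸ hmem.1
          rw [hlp]
          linarith [hiF.2 p₀ hp₀'.1, hp₀'.2 (x i) hiF.1]
        · rw [hlp]
          by_contra! hle
          have hiF : x i ∈ F := by
            rw [hl]
            refine ⟨(hext i).1, fun y hy => ?_⟩
            linarith [hp₀'.2 y hy]
          have hmem := inter_extremePoints_subset_extremePoints_of_subset hsub ⟨hiF, hext i⟩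
          rw [hFS] at hmem
          exact hi (hinj.mem_set_image.mp hmem)
  · rintro ⟨α, β, h0, hpos⟩
    have hnonneg : ∀ i, 0 ≤ α + β ⬝ᵥ x i := fun i => by
      by_cases hi : i ∈ S
      · exact (h0 i hi).ge
      · exact (hpos i hi).le
    refine ⟨_, Or.inr (isExposed_zeroSet hnonneg), ?_⟩
    ext p
    constructor
    · intro hp
      obtain ⟨i, rfl, hi, -⟩ := exists_eq_of_mem_extremePoints_zeroSet hnonneg hp
      refine Set.mem_image_of_mem x ?_
      by_contra hiS
      exact (hpos i hiS).ne' hi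
    · rintro ⟨i, hi, rfl⟩
      exact inter_extremePoints_subset_extremePoints_of_subset (isExposed_zeroSet hnonneg).subset
        ⟨⟨(hext i).1, h0 i hi⟩, hext i⟩

end Faces

section GaleDuality

open scoped Matrix

variable {d : ℕ}

/-- The indices of the points that are not in the standard affine basis. -/
def headIdx (d : ℕ) (a : Fin 3) : Fin (d + 4) := ⟨a, by omega⟩

/-- The index of the origin. -/
def pivotIdx (d : ℕ) : Fin (d + 4) := ⟨3, by omega⟩

/-- The indices of the standard basis vectors. -/
def tailIdx (c : Fin d) : Fin (d + 4) := c.addNat 4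

theorem sum_univ_add_four {M : Type*} [AddCommMonoid M] (f : Fin (d + 4) → M) :
    ∑ i, f i = ∑ a, f (headIdx d a) + f (pivotIdx d) + ∑ c, f (tailIdx c) := by
  rw [Fin.sum_univ_succ, Fin.sum_univ_succ, Fin.sum_univ_succ, Fin.sum_univ_succ,
    Fin.sum_univ_three]
  simp only [← add_assoc]
  rfl

theorem forall_fin_add_four {P : Fin (d + 4) → Prop} :
    (∀ i, P i) ↔ (∀ a, P (headIdx d a)) ∧ P (pivotIdx d) ∧ ∀ c, P (tailIdx c) := by
  refine ⟨fun h => ⟨fun _ => h _, h _, fun _ => h _⟩, fun ⟨h1, h2, h3⟩ i => ?_⟩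
  rcases lt_trichotomy (i : ℕ) 3 with h | h | h
  · exact h1 ⟨i, h⟩
  · exact (show i = pivotIdx d from Fin.ext h) ▸ h2
  · have : i = tailIdx ⟨i - 4, by omega⟩ := Fin.ext (by simp only [tailIdx, Fin.val_addNat]; omega)
    exact this ▸ h3 _

/-- The affine basis of a point configuration is the standard one. -/
def IsStandard (x : Fin (d + 4) → Fin d → ℝ) : Prop :=
  x (pivotIdx d) = 0 ∧ ∀ c, x (tailIdx c) = Pi.single c 1

/-- A Gale dual of a standard point configuration. -/
def galeDual (x : Fin (d + 4) → Fin d → ℝ) (i : Fin (d + 4)) (a : Fin 3) : ℝ :=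
  if h₀ : (i : ℕ) < 3 then (if (i : ℕ) = a then 1 else 0)
  else if h : (i : ℕ) = 3 then -1 + ∑ c, x (headIdx d a) c
  else -x (headIdx d a) ⟨i - 4, by omega⟩

theorem galeDual_head (x : Fin (d + 4) → Fin d → ℝ) (b a : Fin 3) :
    galeDual x (headIdx d b) a = if b = a then 1 else 0 := by
  have hb : (headIdx d b : ℕ) < 3 := b.is_lt
  rw [galeDual, dif_pos hb]
  exact if_congr (Fin.ext_iff (a := b) (b := a)).symm rfl rfl

theorem galeDual_pivot (x : Fin (d + 4) → Fin d → ℝ) (a : Fin 3) :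
    galeDual x (pivotIdx d) a = -1 + ∑ c, x (headIdx d a) c := by
  simp [galeDual, pivotIdx]

theorem galeDual_tail (x : Fin (d + 4) → Fin d → ℝ) (c : Fin d) (a : Fin 3) :
    galeDual x (tailIdx c) a = -x (headIdx d a) c := by
  have h1 : ¬ (c : ℕ) + 4 < 3 := by omega
  have h2 : ¬ (c : ℕ) + 4 = 3 := by omega
  simp [galeDual, tailIdx, h1, h2]

theorem sum_mul_galeDual (x : Fin (d + 4) → Fin d → ℝ) (w : Fin (d + 4) → ℝ) (a : Fin 3) :
    ∑ i, w i * galeDual x i a = w (headIdx d a) - (w (pivotIdx d) +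
      (fun c => w (tailIdx c) - w (pivotIdx d)) ⬝ᵥ x (headIdx d a)) := by
  rw [sum_univ_add_four]
  simp only [galeDual_head, galeDual_pivot, galeDual_tail, mul_ite, mul_one, mul_zero,
    Finset.sum_ite_eq', Finset.mem_univ, if_true, dotProduct, sub_mul, Finset.sum_sub_distrib,
    mul_add, mul_neg, Finset.sum_neg_distrib, Finset.mul_sum]
  ring

theorem sum_galeDual (x : Fin (d + 4) → Fin d → ℝ) : ∑ i, galeDual x i = 0 := by
  ext a
  have := sum_mul_galeDual x (fun _ => 1) a
  simpa [Finset.sum_apply] using this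

theorem sum_smul_galeDual_eq_zero_iff {x : Fin (d + 4) → Fin d → ℝ} (hx : IsStandard x)
    (w : Fin (d + 4) → ℝ) :
    ∑ i, w i • galeDual x i = 0 ↔ ∃ (α : ℝ) (β : Fin d → ℝ), ∀ i, w i = α + β ⬝ᵥ x i := by
  have hcoord : ∑ i, w i • galeDual x i = 0 ↔ ∀ a, w (headIdx d a) = w (pivotIdx d) +
      (fun c => w (tailIdx c) - w (pivotIdx d)) ⬝ᵥ x (headIdx d a) := by
    rw [funext_iff]
    refine forall_congr' fun a => ?_
    rw [Finset.sum_apply]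
    simp only [Pi.smul_apply, smul_eq_mul, Pi.zero_apply, sum_mul_galeDual, sub_eq_zero]
  rw [hcoord]
  constructor
  · intro h
    refine ⟨w (pivotIdx d), fun c => w (tailIdx c) - w (pivotIdx d), ?_⟩
    rw [forall_fin_add_four]
    refine ⟨h, by simp [hx.1], fun c => by simp [hx.2]⟩
  · rintro ⟨α, β, h⟩ a
    have hp : w (pivotIdx d) = α := by simp [h, hx.1]
    have hβ : (fun c => w (tailIdx c) - w (pivotIdx d)) = β := by
      ext c
      rw [hp, h, hx.2]
      simp
    rw [hβ, hp, h]

theorem hasPositiveDependency_galeDual_iff {x : Fin (d + 4) → Fin d → ℝ} (hx : IsStandard x)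
    (S : Finset (Fin (d + 4))) :
    HasPositiveDependency (galeDual x) Sᶜ ↔ ∃ (α : ℝ) (β : Fin d → ℝ),
      (∀ i ∈ S, α + β ⬝ᵥ x i = 0) ∧ ∀ i ∉ S, 0 < α + β ⬝ᵥ x i := by
  constructor
  · rintro ⟨w, h0, hpos, hsum⟩
    obtain ⟨α, β, h⟩ := (sum_smul_galeDual_eq_zero_iff hx w).mp hsum
    exact ⟨α, β, fun i hi => by rw [← h, h0 i (by simpa using hi)],
      fun i hi => by rw [← h]; exact hpos i (by simpa using hi)⟩
  · rintro ⟨α, β, h0, hpos⟩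
    exact ⟨fun i => α + β ⬝ᵥ x i, fun i hi => h0 i (by simpa using hi),
      fun i hi => hpos i (by simpa using hi),
      (sum_smul_galeDual_eq_zero_iff hx _).mpr ⟨α, β, fun _ => rfl⟩⟩

theorem isVertexSetOfFace_iff_hasPositiveDependency {x : Fin (d + 4) → Fin d → ℝ}
    (hx : IsStandard x) (hinj : Function.Injective x)
    (hext : ∀ i, x i ∈ Set.extremePoints ℝ (convexHull ℝ (Set.range x)))
    (S : Finset (Fin (d + 4))) :
    IsVertexSetOfFace x S ↔ HasPositiveDependency (galeDual x) Sᶜ := by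
  rw [hasPositiveDependency_galeDual_iff hx, isVertexSetOfFace_iff hinj hext]

theorem injective_of_hasPositiveDependency {x : Fin (d + 4) → Fin d → ℝ} (hx : IsStandard x)
    (h : ∀ i, HasPositiveDependency (galeDual x) {i}ᶜ) : Function.Injective x := by
  intro i j hij
  by_contra hne
  obtain ⟨α, β, h0, hpos⟩ := (hasPositiveDependency_galeDual_iff hx {i}).mp (h i)
  have h1 := h0 i (by simp)
  have h2 := hpos j (by simpa using Ne.symm hne)
  rw [← hij] at h2
  exact h2.ne' h1

theorem mem_extremePoints_of_hasPositiveDependency {x : Fin (d + 4) → Fin d → ℝ}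
    (hx : IsStandard x) {i : Fin (d + 4)} (h : HasPositiveDependency (galeDual x) {i}ᶜ) :
    x i ∈ Set.extremePoints ℝ (convexHull ℝ (Set.range x)) := by
  obtain ⟨α, β, h0, hpos⟩ := (hasPositiveDependency_galeDual_iff hx {i}).mp h
  exact mem_extremePoints_of_zeroSet (h0 i (by simp)) fun j hj => hpos j (by simpa using hj)

/-- The indices of the standard affine basis. -/
def basisIdx (d : ℕ) : Finset (Fin (d + 4)) := Finset.univ.filter fun i => 3 ≤ (i : ℕ)

theorem forall_mem_basisIdx {P : Fin (d + 4) → Prop} :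
    (∀ i ∈ basisIdx d, P i) ↔ P (pivotIdx d) ∧ ∀ c, P (tailIdx c) := by
  rw [forall_fin_add_four (P := fun i => i ∈ basisIdx d → P i)]
  simp [basisIdx, headIdx, pivotIdx, tailIdx]

theorem card_basisIdx (d : ℕ) : (basisIdx d).card = d + 1 := by
  rw [basisIdx, Finset.card_filter, sum_univ_add_four]
  have h : ∀ a : Fin 3, ¬ 3 ≤ (a : ℕ) := fun a => by omega
  simp [headIdx, pivotIdx, tailIdx, add_comm, h]

theorem IsStandard.affineIndependent {x : Fin (d + 4) → Fin d → ℝ} (hx : IsStandard x) :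
    AffineIndependent ℝ (fun i : ↥(basisIdx d) => x i) := by
  rw [affineIndependent_iff_of_fintype]
  intro w hw hw'
  rw [Finset.univ.weightedVSub_eq_weightedVSubOfPoint_of_sum_eq_zero _ _ hw 0,
    Finset.weightedVSubOfPoint_apply] at hw'
  simp only [vsub_eq_sub, sub_zero] at hw'
  set u : Fin (d + 4) → ℝ := fun i => if h : i ∈ basisIdx d then w ⟨i, h⟩ else 0 with hu
  have hwu : ∀ i : ↥(basisIdx d), w i = u i := fun i => by rw [hu]; simp
  have hhead : ∀ a, u (headIdx d a) = 0 := fun a => dif_neg (by simp [basisIdx, headIdx])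
  have hext : ∀ {M : Type} [AddCommMonoid M] (f : Fin (d + 4) → M), (∀ a, f (headIdx d a) = 0) →
      ∑ i : ↥(basisIdx d), f i = f (pivotIdx d) + ∑ c, f (tailIdx c) := by
    intro M _ f hf
    rw [Finset.sum_coe_sort (basisIdx d) f, basisIdx, Finset.sum_filter, sum_univ_add_four]
    have h : ∀ a : Fin 3, ¬ 3 ≤ (a : ℕ) := fun a => by omega
    simp [headIdx, pivotIdx, tailIdx, h]
  simp only [hwu] at hw hw' ⊢
  rw [hext u hhead] at hw
  rw [hext (fun i => u i • x i) (fun a => by rw [hhead, zero_smul]), hx.1, smul_zero,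
    zero_add] at hw'
  have htail : ∀ c, u (tailIdx c) = 0 := by
    intro c
    have := congrFun hw' c
    simpa [hx.2, Finset.sum_apply, Pi.single_apply] using this
  simp only [htail, Finset.sum_const_zero, add_zero] at hw
  rw [Subtype.forall]
  exact forall_mem_basisIdx (P := fun i => u i = 0).mpr ⟨hw, htail⟩

theorem IsStandard.affineSpan_eq_top {x : Fin (d + 4) → Fin d → ℝ} (hx : IsStandard x) :
    affineSpan ℝ (Set.range x) = ⊤ := by
  have h : affineSpan ℝ (Set.range fun i : ↥(basisIdx d) => x i) = ⊤ := by
    rw [hx.affineIndependent.affineSpan_eq_top_iff_card_eq_finrank_add_one]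
    simp [card_basisIdx]
  refine top_le_iff.mp (h ▸ affineSpan_mono ℝ ?_)
  rintro _ ⟨i, rfl⟩
  exact Set.mem_range_self _

end GaleDuality

section RealizationSpaces

open scoped Matrix

variable {n d : ℕ}

theorem sign_eq_sign_iff_mul_pos {t x : ℝ} (ht : t ≠ 0) :
    Real.sign x = Real.sign t ↔ 0 < t * x := by
  rw [sign_eq_sign_iff (Real.sign_eq_zero_iff.not.mpr ht)]
  rcases lt_or_gt_of_ne ht with h | h
  · rw [Real.sign_of_neg h, neg_one_mul, neg_pos]
    exact ⟨mul_pos_of_neg_of_neg h, fun hx => (neg_iff_neg_of_mul_pos hx).mp h⟩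
  · rw [Real.sign_of_pos h, one_mul, mul_pos_iff_of_pos_left h]

theorem card_negativeSide_of_sum_sign_eq_zero {ι : Type*} [Fintype ι] [DecidableEq ι]
    {W : ι → Fin 3 → ℝ} (hW : IsUniformConfiguration W) {a b : ι} (hab : a ≠ b)
    (h : ∑ i, Real.sign (det3 (W a) (W b) (W i)) = 0) :
    2 * (negativeSide W (W a ⨯₃ W b)).card + 2 = Fintype.card ι := by
  have hind : ∀ i, 2 * (if (W a ⨯₃ W b) ⬝ᵥ W i < 0 then (1 : ℝ) else 0) + (if i = a then 1 else 0) +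
      (if i = b then 1 else 0) = 1 - Real.sign (det3 (W a) (W b) (W i)) := by
    intro i
    rw [← det3_eq_cross]
    by_cases hia : i = a
    · subst hia
      simp [det3_self_outer, hab]
    by_cases hib : i = b
    · subst hib
      simp [det3_self_right, Ne.symm hab]
    rcases lt_or_gt_of_ne (hW a b i hab (Ne.symm hia) (Ne.symm hib)) with h0 | h0
    · norm_num [h0, hia, hib, Real.sign_of_neg h0]
    · norm_num [h0.not_gt, hia, hib, Real.sign_of_pos h0]
  have hsum := Finset.sum_congr (rfl : Finset.univ = Finset.univ) fun i _ => hind i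
  rw [Finset.sum_sub_distrib, h, Finset.sum_add_distrib, Finset.sum_add_distrib, ← Finset.mul_sum,
    Finset.sum_boole] at hsum
  simp only [Finset.sum_ite_eq', Finset.mem_univ, if_true, Finset.sum_const, nsmul_eq_mul, mul_one,
    sub_zero, Finset.card_univ] at hsum
  have : (2 * (negativeSide W (W a ⨯₃ W b)).card + 2 : ℝ) = Fintype.card ι := by
    rw [← hsum, negativeSide]
    ring
  exact_mod_cast this

theorem IsDoublingSign.isUniformConfiguration {s : ℕ → ℕ → ℕ → ℝ} (h : IsDoublingSign n s)
    (hn : 3 ≤ n) {N : ℕ} (hN : N = 2 * n) {W : Fin N → Fin 3 → ℝ}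
    (hW : W ∈ signRealizationSpace s N) : IsUniformConfiguration W := by
  intro i j k hij hik hjk h0
  have hs := hW.2 i j k hij hik hjk
  rw [h0, Real.sign_zero] at hs
  exact h.isUniform hn (hN ▸ i.2) (hN ▸ j.2) (hN ▸ k.2) (Fin.val_ne_of_ne hij)
    (Fin.val_ne_of_ne hik) (Fin.val_ne_of_ne hjk) hs.symm

theorem IsDoublingSign.isBalancedConfiguration {s : ℕ → ℕ → ℕ → ℝ} (h : IsDoublingSign n s)
    (hn : 3 ≤ n) {N : ℕ} (hN : N = 2 * n) {W : Fin N → Fin 3 → ℝ}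
    (hW : W ∈ signRealizationSpace s N) : IsBalancedConfiguration n W := by
  have hU := h.isUniformConfiguration hn hN hW
  have hcard : Fintype.card (Fin N) = 2 * n := by simp [hN]
  refine hU.isBalancedConfiguration hn hcard fun a b hab => ?_
  have hsum : ∑ i, Real.sign (det3 (W a) (W b) (W i)) = 0 := by
    rw [← h.sum_eq_zero hn (hN ▸ a.2 : (a : ℕ) < 2 * n) (hN ▸ b.2 : (b : ℕ) < 2 * n), ← hN,
      ← Fin.sum_univ_eq_sum_range]
    refine Finset.sum_congr rfl fun i _ => ?_
    by_cases hia : a = i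
    · rw [hia, det3_self_outer, h.self_outer, Real.sign_zero]
    by_cases hib : b = i
    · rw [hib, det3_self_right, h.self_right, Real.sign_zero]
    exact hW.2 a b i hab hia hib
  have := card_negativeSide_of_sum_sign_eq_zero hU hab hsum
  omega

theorem IsBalancedConfiguration.hasPositiveDependency_compl_singleton (hn : 3 ≤ n)
    (hN : d + 4 = 2 * n) {W : Fin (d + 4) → Fin 3 → ℝ} (hB : IsBalancedConfiguration n W)
    (i : Fin (d + 4)) : HasPositiveDependency W {i}ᶜ := by
  have hcard : Fintype.card (Fin (d + 4)) = 2 * n := by simp [hN]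
  refine hB.hasPositiveDependency (hB.isUniformConfiguration hcard) hcard ?_
  rw [compl_compl, Finset.card_singleton]
  omega

theorem galeDual_head_eq_single (x : Fin (d + 4) → Fin d → ℝ) (b : Fin 3) :
    galeDual x (headIdx d b) = Pi.single b 1 := by
  ext a
  rw [galeDual_head, Pi.single_apply]
  simp only [eq_comm]

theorem det3_galeDual_head (x : Fin (d + 4) → Fin d → ℝ) :
    det3 (galeDual x (headIdx d 0)) (galeDual x (headIdx d 1)) (galeDual x (headIdx d 2)) = 1 := by
  simp [det3, galeDual_head]

theorem isStandard_iff {x : Fin (d + 4) → Fin d → ℝ} {v : Fin (d + 4) → Fin d → ℝ}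
    (hv : IsStandard v) : (∀ i ∈ basisIdx d, x i = v i) ↔ IsStandard x := by
  rw [forall_mem_basisIdx, IsStandard, hv.1]
  simp only [hv.2]

theorem mem_polytopeRealizationSpace_iff (hn : 3 ≤ n) (hN : d + 4 = 2 * n)
    {v : Fin (d + 4) → Fin d → ℝ} (hv : IsStandard v) (hB : IsBalancedConfiguration n (galeDual v))
    (x : Fin (d + 4) → Fin d → ℝ) :
    x ∈ polytopeRealizationSpace v (basisIdx d) ↔ IsStandard x ∧ ∀ i j k, i ≠ j → i ≠ k → j ≠ k →
      0 < det3 (galeDual v i) (galeDual v j) (galeDual v k) *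
        det3 (galeDual x i) (galeDual x j) (galeDual x k) := by
  have hcard : Fintype.card (Fin (d + 4)) = 2 * n := by simp [hN]
  have hU := hB.isUniformConfiguration hcard
  have hsing := hB.hasPositiveDependency_compl_singleton hn hN
  have hface := isVertexSetOfFace_iff_hasPositiveDependency hv
    (injective_of_hasPositiveDependency hv hsing)
    (fun i => mem_extremePoints_of_hasPositiveDependency hv (hsing i))
  have hhead : ∀ {a b : Fin 3}, a ≠ b → headIdx d a ≠ headIdx d b := fun hab h =>
    hab (Fin.ext (by simpa [headIdx] using h))
  constructor
  · rintro ⟨hx, hext, hfaces⟩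
    rw [isStandard_iff hv] at hx
    have hinj : Function.Injective x := by
      intro i j hij
      by_contra hne
      have h1 : IsVertexSetOfFace x {j}ᶜ := by
        refine ⟨_, Or.inl rfl, subset_antisymm (fun p hp => ?_) ?_⟩
        · obtain ⟨k, rfl⟩ := extremePoints_convexHull_subset hp
          by_cases hk : k = j
          · exact ⟨i, by simpa using hne, by rw [hij, hk]⟩
          · exact ⟨k, by simpa using hk, rfl⟩
        · rintro _ ⟨k, -, rfl⟩
          exact hext k
      rw [hfaces, hface, compl_compl] at h1
      exact Finset.singleton_ne_empty j
        (h1.eq_empty_of_card_le hU (by omega) (by simp))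
    have hiff : ∀ T, HasPositiveDependency (galeDual x) T ↔ HasPositiveDependency (galeDual v) T := by
      intro T
      have := hfaces Tᶜ
      rwa [hface, isVertexSetOfFace_iff_hasPositiveDependency hx hinj hext, compl_compl] at this
    have hD := det3_galeDual_head x
    have hB' : IsBalancedConfiguration n (galeDual x) :=
      isBalancedConfiguration_of_hasPositiveDependency (by omega)
        (fun T hT => (hiff T).mpr (hB.hasPositiveDependency hU hcard hT))
        (hD.trans_ne one_ne_zero)
    refine ⟨hx, sign_eq_of_hasPositiveDependency_iff hB hU hB' (hB'.isUniformConfiguration hcard) hn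
      hcard (fun T => (hiff T).mp) (hhead (a := 0) (b := 1) (by decide))
      (hhead (b := 2) (by decide)) (hhead (by decide)) ?_⟩
    rw [hD, det3_galeDual_head v]
    norm_num
  · rintro ⟨hx, hs⟩
    have hU' : IsUniformConfiguration (galeDual x) := fun i j k hij hik hjk =>
      right_ne_zero_of_mul (hs i j k hij hik hjk).ne'
    have hiff : ∀ T, HasPositiveDependency (galeDual x) T ↔ HasPositiveDependency (galeDual v) T :=
      fun T => ⟨.of_sign_eq hU' hU (by omega) fun i j k hij hik hjk => by
        rw [mul_comm]; exact hs i j k hij hik hjk, .of_sign_eq hU hU' (by omega) hs⟩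
    have hsing' := fun i => (hiff {i}ᶜ).mpr (hsing i)
    have hext := fun i => mem_extremePoints_of_hasPositiveDependency hx (hsing' i)
    refine ⟨(isStandard_iff hv).mpr hx, hext, fun S => ?_⟩
    rw [hface, isVertexSetOfFace_iff_hasPositiveDependency hx
      (injective_of_hasPositiveDependency hx hsing') hext, hiff]

theorem mem_polytopeRealizationSpace_iff_mem_signRealizationSpace (hn : 3 ≤ n)
    (hN : d + 4 = 2 * n) {s : ℕ → ℕ → ℕ → ℝ} (hs : IsDoublingSign n s)
    {v : Fin (d + 4) → Fin d → ℝ} (hv : IsStandard v)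
    (hvs : galeDual v ∈ signRealizationSpace s (d + 4)) (x : Fin (d + 4) → Fin d → ℝ) :
    x ∈ polytopeRealizationSpace v (basisIdx d) ↔
      IsStandard x ∧ galeDual x ∈ signRealizationSpace s (d + 4) := by
  rw [mem_polytopeRealizationSpace_iff hn hN hv (hs.isBalancedConfiguration hn hN hvs)]
  have hU := hs.isUniformConfiguration hn hN hvs
  refine and_congr_right fun _ => ⟨fun h => ⟨fun i a hi => ?_, fun i j k hij hik hjk => ?_⟩,
    fun h i j k hij hik hjk => ?_⟩
  · rw [show i = headIdx d a from Fin.ext hi, galeDual_head_eq_single]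
  · rw [← hvs.2 i j k hij hik hjk, sign_eq_sign_iff_mul_pos (hU i j k hij hik hjk)]
    exact h i j k hij hik hjk
  · rw [← sign_eq_sign_iff_mul_pos (hU i j k hij hik hjk), hvs.2 i j k hij hik hjk,
      h.2 i j k hij hik hjk]

end RealizationSpaces

section Flattening

variable {n d : ℕ}

theorem exists_flatIdx_eq (k : Fin (d * n)) : ∃ (p : Fin n) (c : Fin d), flatIdx p c = k := by
  have hd : 0 < d := Nat.pos_of_ne_zero fun h => by
    have := k.2
    simp [h] at this
  exact ⟨⟨k / d, Nat.div_lt_of_lt_mul k.2⟩, ⟨k % d, Nat.mod_lt _ hd⟩,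
    Fin.ext (Nat.div_add_mod (k : ℕ) d)⟩

theorem flatIdx_injective {p p' : Fin n} {c c' : Fin d} (h : flatIdx p c = flatIdx p' c') :
    p = p' ∧ c = c' := by
  have h' : d * (p : ℕ) + c = d * (p' : ℕ) + c' := congrArg Fin.val h
  have hd : 0 < d := c.pos
  have h1 := congrArg (· / d) h'
  have h2 := congrArg (· % d) h'
  simp only [Nat.mul_add_div hd, Nat.div_eq_of_lt c.2, Nat.div_eq_of_lt c'.2, Nat.mul_add_mod,
    Nat.mod_eq_of_lt c.2, Nat.mod_eq_of_lt c'.2, add_zero] at h1 h2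
  exact ⟨Fin.ext h1, Fin.ext h2⟩

/-- The list of coordinates of a point configuration. -/
def flatten (x : Fin n → Fin d → ℝ) (k : Fin (d * n)) : ℝ :=
  x (exists_flatIdx_eq k).choose (exists_flatIdx_eq k).choose_spec.choose

theorem flatten_flatIdx (x : Fin n → Fin d → ℝ) (p : Fin n) (c : Fin d) :
    flatten x (flatIdx p c) = x p c := by
  obtain ⟨hp, hc⟩ := flatIdx_injective (exists_flatIdx_eq (flatIdx p c)).choose_spec.choose_spec
  exact congr_arg₂ x hp hc

/-- The points underlying a weighted point configuration. -/
def points (z : Fin (d * n + n) → ℝ) : Fin n → Fin d → ℝ :=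
  unflatten fun k => z (Fin.castAdd n k)

/-- The weights underlying a weighted point configuration. -/
def weights (z : Fin (d * n + n) → ℝ) (j : Fin n) : ℝ := z (Fin.natAdd (d * n) j)

/-- The list of coordinates of a weighted point configuration. -/
def weighted (x : Fin n → Fin d → ℝ) (w : Fin n → ℝ) : Fin (d * n + n) → ℝ :=
  Fin.append (flatten x) w

theorem points_weighted (x : Fin n → Fin d → ℝ) (w : Fin n → ℝ) : points (weighted x w) = x := by
  ext p c
  rw [points, unflatten, weighted, Fin.append_left, flatten_flatIdx]

theorem weights_weighted (x : Fin n → Fin d → ℝ) (w : Fin n → ℝ) : weights (weighted x w) = w := by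
  ext j
  rw [weights, weighted, Fin.append_right]

theorem weighted_points_weights (z : Fin (d * n + n) → ℝ) : weighted (points z) (weights z) = z := by
  ext k
  refine Fin.addCases (fun k => ?_) (fun j => ?_) k
  · obtain ⟨p, c, rfl⟩ := exists_flatIdx_eq k
    rw [weighted, Fin.append_left, flatten_flatIdx, points, unflatten]
  · rw [weighted, Fin.append_right, weights]

theorem isRationalMapOn_weighted {D : ℕ} {S : Set (Fin D → ℝ)} {x : (Fin D → ℝ) → Fin n → Fin d → ℝ}
    {w : (Fin D → ℝ) → Fin n → ℝ}
    (hx : ∀ p c, ∃ f g : MvPolynomial (Fin D) ℝ, ∀ z ∈ S,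
      MvPolynomial.eval z g ≠ 0 ∧ x z p c = MvPolynomial.eval z f / MvPolynomial.eval z g)
    (hw : ∀ j, ∃ i, ∀ z ∈ S, w z j = z i) :
    IsRationalMapOn S fun z => weighted (x z) (w z) := by
  intro k
  refine Fin.addCases (fun k => ?_) (fun j => ?_) k
  · obtain ⟨p, c, rfl⟩ := exists_flatIdx_eq k
    simpa only [weighted, Fin.append_left, flatten_flatIdx] using hx p c
  · obtain ⟨i, hi⟩ := hw j
    refine ⟨MvPolynomial.X i, 1, fun z hz => ?_⟩
    simp only [weighted, Fin.append_right, map_one, ne_eq, one_ne_zero, not_false_eq_true,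
      MvPolynomial.eval_X, div_one, true_and, hi z hz]

theorem mem_weightSpace_flat {k : ℕ} {R : Set (Fin n → Fin d → ℝ)}
    {A : Fin k → Fin n → MvPolynomial (Fin (d * n)) ℝ} {z : Fin (d * n + n) → ℝ} :
    z ∈ weightSpace (flat R) A ↔ points z ∈ R ∧
      (∀ i, ∑ j, MvPolynomial.eval (fun l => z (Fin.castAdd n l)) (A i j) * weights z j = 0) ∧
        ∀ j, 0 < weights z j := Iff.rfl

end Flattening

section GaleTransform

variable {d : ℕ}

/-- The standard point configuration with the given Gale dual, up to rescaling. -/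
def galePoints (W : Fin (d + 4) → Fin 3 → ℝ) (w : Fin (d + 4) → ℝ) (i : Fin (d + 4)) (c : Fin d) : ℝ :=
  if h : (i : ℕ) < 3 then -(w (tailIdx c) * W (tailIdx c) ⟨i, h⟩) / w i
  else if (i : ℕ) = c + 4 then 1 else 0

/-- The Gale dual of a weighted point configuration. -/
def galeVectors (x : Fin (d + 4) → Fin d → ℝ) (w : Fin (d + 4) → ℝ) (i : Fin (d + 4))
    (a : Fin 3) : ℝ :=
  w (headIdx d a) * galeDual x i a / w i

theorem galePoints_head (W : Fin (d + 4) → Fin 3 → ℝ) (w : Fin (d + 4) → ℝ) (a : Fin 3)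
    (c : Fin d) : galePoints W w (headIdx d a) c =
      -(w (tailIdx c) * W (tailIdx c) a) / w (headIdx d a) := by
  have ha : (headIdx d a : ℕ) < 3 := a.is_lt
  rw [galePoints, dif_pos ha]
  rfl

theorem isStandard_galePoints (W : Fin (d + 4) → Fin 3 → ℝ) (w : Fin (d + 4) → ℝ) :
    IsStandard (galePoints W w) := by
  refine ⟨?_, fun c => ?_⟩ <;> ext c'
  · simp [galePoints, pivotIdx]
  · have h : ¬ (c : ℕ) + 4 < 3 := by omega
    simp [galePoints, tailIdx, h, Pi.single_apply, Fin.ext_iff, eq_comm]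

theorem sum_mul_eq_zero_iff_sum_smul {ι : Type*} [Fintype ι] {W : ι → Fin 3 → ℝ} {w : ι → ℝ} :
    (∀ a, ∑ j, W j a * w j = 0) ↔ ∑ j, w j • W j = 0 := by
  rw [funext_iff]
  simp only [Finset.sum_apply, Pi.smul_apply, smul_eq_mul, Pi.zero_apply, mul_comm]

theorem galeDual_galePoints {W : Fin (d + 4) → Fin 3 → ℝ} {w : Fin (d + 4) → ℝ}
    (hW : ∀ b, W (headIdx d b) = Pi.single b 1) (hw : ∀ j, 0 < w j)
    (hsum : ∀ a, ∑ j, W j a * w j = 0) (i : Fin (d + 4)) (a : Fin 3) :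
    galeDual (galePoints W w) i a = w i * W i a / w (headIdx d a) := by
  have hne : ∀ j, w j ≠ 0 := fun j => (hw j).ne'
  have hhead : ∀ b, W (headIdx d b) a = if b = a then 1 else 0 := fun b => by
    rw [hW, Pi.single_apply]
    simp only [eq_comm]
  revert i
  rw [forall_fin_add_four]
  refine ⟨fun b => ?_, ?_, fun c => ?_⟩
  · rw [galeDual_head, hhead]
    split_ifs with h
    · rw [h, mul_one, div_self (hne _)]
    · simp
  · have h := hsum a
    rw [sum_univ_add_four] at h
    simp only [hhead, ite_mul, one_mul, zero_mul, Finset.sum_ite_eq', Finset.mem_univ,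
      if_true] at h
    rw [galeDual_pivot, eq_div_iff (hne _)]
    simp only [galePoints_head]
    rw [← Finset.sum_div, Finset.sum_neg_distrib, add_mul, div_mul_cancel₀ _ (hne _)]
    simp only [mul_comm (w _) (W _ _)]
    linarith
  · rw [galeDual_tail, galePoints_head, neg_div, neg_neg]

theorem galePoints_galeVectors {x : Fin (d + 4) → Fin d → ℝ} (hx : IsStandard x)
    {w : Fin (d + 4) → ℝ} (hw : ∀ j, 0 < w j) : galePoints (galeVectors x w) w = x := by
  have hst := isStandard_galePoints (galeVectors x w) w
  rw [funext_iff, forall_fin_add_four]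
  refine ⟨fun a => ?_, hst.1.trans hx.1.symm, fun c => (hst.2 c).trans (hx.2 c).symm⟩
  ext c
  have h1 := (hw (tailIdx c)).ne'
  have h2 := (hw (headIdx d a)).ne'
  rw [galePoints_head, galeVectors, galeDual_tail]
  field_simp

theorem galeVectors_galePoints {W : Fin (d + 4) → Fin 3 → ℝ} {w : Fin (d + 4) → ℝ}
    (hW : ∀ b, W (headIdx d b) = Pi.single b 1) (hw : ∀ j, 0 < w j)
    (hsum : ∀ a, ∑ j, W j a * w j = 0) : galeVectors (galePoints W w) w = W := by
  ext i a
  have h1 := (hw i).ne'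
  have h2 := (hw (headIdx d a)).ne'
  rw [galeVectors, galeDual_galePoints hW hw hsum]
  field_simp

theorem sum_galeVectors_mul (x : Fin (d + 4) → Fin d → ℝ) {w : Fin (d + 4) → ℝ}
    (hw : ∀ j, 0 < w j) (a : Fin 3) : ∑ j, galeVectors x w j a * w j = 0 := by
  have h := congrFun (sum_galeDual x) a
  rw [Finset.sum_apply, Pi.zero_apply] at h
  simp only [galeVectors, div_mul_cancel₀ _ (hw _).ne', ← Finset.mul_sum, h, mul_zero]

theorem det3_scale (l₁ l₂ l₃ : ℝ) (m u v w : Fin 3 → ℝ) :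
    det3 (fun a => l₁ * u a * m a) (fun a => l₂ * v a * m a) (fun a => l₃ * w a * m a) =
      l₁ * l₂ * l₃ * (m 0 * m 1 * m 2) * det3 u v w := by
  simp only [det3]
  ring

theorem mem_signRealizationSpace_of_scale {s : ℕ → ℕ → ℕ → ℝ} {W W' : Fin (d + 4) → Fin 3 → ℝ}
    (hW : W ∈ signRealizationSpace s (d + 4)) (hW' : ∀ b, W' (headIdx d b) = Pi.single b 1)
    {l : Fin (d + 4) → ℝ} {m : Fin 3 → ℝ} (hl : ∀ i, 0 < l i) (hm : ∀ a, 0 < m a)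
    (h : ∀ i a, W' i a = l i * W i a * m a) : W' ∈ signRealizationSpace s (d + 4) := by
  refine ⟨fun i a hi => (show i = headIdx d a from Fin.ext hi) ▸ hW' a,
    fun i j k hij hik hjk => ?_⟩
  have hrow : ∀ i, W' i = fun a => l i * W i a * m a := fun i => funext (h i)
  rw [hrow, hrow, hrow, det3_scale, sign_mul_of_pos, hW.2 i j k hij hik hjk]
  have := hl i
  have := hl j
  have := hl k
  have := hm 0
  have := hm 1
  have := hm 2
  positivity

theorem signRealizationSpace.head {s : ℕ → ℕ → ℕ → ℝ} {W : Fin (d + 4) → Fin 3 → ℝ}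
    (hW : W ∈ signRealizationSpace s (d + 4)) (b : Fin 3) : W (headIdx d b) = Pi.single b 1 :=
  hW.1 _ b rfl

theorem galeDual_galePoints_mem {s : ℕ → ℕ → ℕ → ℝ} {W : Fin (d + 4) → Fin 3 → ℝ}
    (hW : W ∈ signRealizationSpace s (d + 4)) {w : Fin (d + 4) → ℝ} (hw : ∀ j, 0 < w j)
    (hsum : ∀ a, ∑ j, W j a * w j = 0) :
    galeDual (galePoints W w) ∈ signRealizationSpace s (d + 4) :=
  mem_signRealizationSpace_of_scale hW (galeDual_head_eq_single _) hw
    (m := fun a => (w (headIdx d a))⁻¹) (fun _ => inv_pos.mpr (hw _)) fun i a => by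
      rw [galeDual_galePoints (signRealizationSpace.head hW) hw hsum, div_eq_mul_inv]

theorem galeVectors_mem {s : ℕ → ℕ → ℕ → ℝ} {x : Fin (d + 4) → Fin d → ℝ}
    (hx : galeDual x ∈ signRealizationSpace s (d + 4)) {w : Fin (d + 4) → ℝ} (hw : ∀ j, 0 < w j) :
    galeVectors x w ∈ signRealizationSpace s (d + 4) := by
  refine mem_signRealizationSpace_of_scale hx (fun b => ?_) (l := fun i => (w i)⁻¹)
    (fun _ => inv_pos.mpr (hw _)) (m := fun a => w (headIdx d a)) (fun _ => hw _) fun i a => ?_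
  · ext a
    rw [galeVectors, galeDual_head, Pi.single_apply]
    by_cases h : b = a
    · simp [h, (hw _).ne']
    · simp [h, Ne.symm h]
  · rw [galeVectors]
    ring

theorem exists_polynomial_galeDual (i : Fin (d + 4)) (a : Fin 3) :
    ∃ f : MvPolynomial (Fin (d * (d + 4))) ℝ, ∀ y, galeDual (unflatten y) i a =
      MvPolynomial.eval y f := by
  revert i
  rw [forall_fin_add_four]
  refine ⟨fun b => ⟨MvPolynomial.C (if b = a then 1 else 0), fun y => ?_⟩,
    ⟨-1 + ∑ c, MvPolynomial.X (flatIdx (headIdx d a) c), fun y => ?_⟩,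
    fun c => ⟨-MvPolynomial.X (flatIdx (headIdx d a) c), fun y => ?_⟩⟩
  · rw [galeDual_head, MvPolynomial.eval_C]
  · simp [galeDual_pivot, unflatten]
  · simp [galeDual_tail, unflatten]

theorem IsDoublingSign.exists_weights {n : ℕ} (hn : 3 ≤ n) (hN : d + 4 = 2 * n)
    {s : ℕ → ℕ → ℕ → ℝ} (hs : IsDoublingSign n s) {W : Fin (d + 4) → Fin 3 → ℝ}
    (hW : W ∈ signRealizationSpace s (d + 4)) :
    ∃ w : Fin (d + 4) → ℝ, (∀ j, 0 < w j) ∧ ∀ a, ∑ j, W j a * w j = 0 := by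
  obtain ⟨w, -, hw, hsum⟩ := (hs.isBalancedConfiguration hn hN hW).hasPositiveDependency
    (hs.isUniformConfiguration hn hN hW) (by simp [hN]) (T := Finset.univ) (by simp; omega)
  exact ⟨w, fun j => hw j (Finset.mem_univ j), sum_mul_eq_zero_iff_sum_smul.mpr hsum⟩

/-- The weighted vector configurations realizing given signs, with weighted sum zero, correspond
to the weighted standard point configurations whose Gale duals realize these signs. -/
theorem rationallyEquivalent_galeDual (s : ℕ → ℕ → ℕ → ℝ) {R : Set (Fin (d + 4) → Fin d → ℝ)}
    (hR : ∀ x, x ∈ R ↔ IsStandard x ∧ galeDual x ∈ signRealizationSpace s (d + 4)) :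
    RationallyEquivalent
      (weightSpace (flat (signRealizationSpace s (d + 4)))
        fun (a : Fin 3) i => MvPolynomial.X (flatIdx i a))
      (weightSpace (flat R) fun (a : Fin 0) (_ : Fin (d + 4)) => a.elim0) := by
  have hT : ∀ z, z ∈ weightSpace (flat (signRealizationSpace s (d + 4)))
      (fun (a : Fin 3) i => MvPolynomial.X (flatIdx i a)) ↔
        points z ∈ signRealizationSpace s (d + 4) ∧ (∀ a, ∑ j, points z j a * weights z j = 0) ∧
          ∀ j, 0 < weights z j := by
    intro z
    rw [mem_weightSpace_flat]
    simp only [MvPolynomial.eval_X]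
    rfl
  have hU : ∀ z, z ∈ weightSpace (flat R) (fun (a : Fin 0) (_ : Fin (d + 4)) => a.elim0) ↔
      (IsStandard (points z) ∧ galeDual (points z) ∈ signRealizationSpace s (d + 4)) ∧
        ∀ j, 0 < weights z j := by
    intro z
    rw [mem_weightSpace_flat, hR]
    simp
  refine ⟨fun z => weighted (galePoints (points z) (weights z)) (weights z),
    fun z => weighted (galeVectors (points z) (weights z)) (weights z), ?_, ?_, ?_, ?_, ?_, ?_⟩
  · refine isRationalMapOn_weighted (fun p c => ?_) fun j => ⟨Fin.natAdd _ j, fun _ _ => rfl⟩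
    revert p
    rw [forall_fin_add_four]
    refine ⟨fun a => ⟨-(MvPolynomial.X (Fin.natAdd _ (tailIdx c)) *
      MvPolynomial.X (Fin.castAdd _ (flatIdx (tailIdx c) a))),
        MvPolynomial.X (Fin.natAdd _ (headIdx d a)), fun z hz => ?_⟩,
        ⟨0, 1, fun z _ => ?_⟩, fun c' => ⟨MvPolynomial.C (Pi.single (M := fun _ => ℝ) c' 1 c), 1,
        fun z _ => ?_⟩⟩
    · rw [MvPolynomial.eval_X, galePoints_head]
      refine ⟨(((hT z).mp hz).2.2 (headIdx d a)).ne', ?_⟩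
      simp only [map_neg, map_mul, MvPolynomial.eval_X]
      rfl
    · simp [(isStandard_galePoints _ _).1]
    · simp [(isStandard_galePoints _ _).2]
  · refine isRationalMapOn_weighted (fun i a => ?_) fun j => ⟨Fin.natAdd _ j, fun _ _ => rfl⟩
    obtain ⟨f, hf⟩ := exists_polynomial_galeDual i a
    refine ⟨MvPolynomial.X (Fin.natAdd _ (headIdx d a)) * MvPolynomial.rename (Fin.castAdd _) f,
      MvPolynomial.X (Fin.natAdd _ i), fun z hz => ?_⟩
    rw [MvPolynomial.eval_X, map_mul, MvPolynomial.eval_X, MvPolynomial.eval_rename]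
    refine ⟨(((hU z).mp hz).2 i).ne', ?_⟩
    rw [galeVectors, points, hf]
    rfl
  · intro z hz
    obtain ⟨h1, h2, h3⟩ := (hT z).mp hz
    rw [hU, points_weighted, weights_weighted]
    exact ⟨⟨isStandard_galePoints _ _, galeDual_galePoints_mem h1 h3 h2⟩, h3⟩
  · intro z hz
    obtain ⟨⟨h1, h2⟩, h3⟩ := (hU z).mp hz
    rw [hT, points_weighted, weights_weighted]
    exact ⟨galeVectors_mem h2 h3, sum_galeVectors_mul _ h3, h3⟩
  · intro z hz
    obtain ⟨h1, h2, h3⟩ := (hT z).mp hz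
    simp only [points_weighted, weights_weighted]
    rw [galeVectors_galePoints (signRealizationSpace.head h1) h3 h2, weighted_points_weights]
  · intro z hz
    obtain ⟨⟨h1, h2⟩, h3⟩ := (hU z).mp hz
    simp only [points_weighted, weights_weighted]
    rw [galePoints_galeVectors h1 h3, weighted_points_weights]

end GaleTransform

section Normalization

variable {n : ℕ}

theorem det3_cofactors (v₀ v₁ v₂ u v w : Fin 3 → ℝ) :
    det3 ![det3 u v₁ v₂, det3 v₀ u v₂, det3 v₀ v₁ u] ![det3 v v₁ v₂, det3 v₀ v v₂, det3 v₀ v₁ v]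
      ![det3 w v₁ v₂, det3 v₀ w v₂, det3 v₀ v₁ w] = det3 v₀ v₁ v₂ ^ 2 * det3 u v w := by
  simp only [det3, Matrix.cons_val]
  ring

theorem uniformChirotopeRealizationSpace_nonempty (hn : 3 ≤ n) {χ : Fin n → Fin n → Fin n → ℝ}
    (hχ : IsRealizableUniformChirotope χ)
    (hnorm : χ ⟨0, by omega⟩ ⟨1, by omega⟩ ⟨2, by omega⟩ = 1) :
    (uniformChirotopeRealizationSpace hn χ).Nonempty := by
  obtain ⟨-, -, v, hv⟩ := hχ
  set v₀ := v ⟨0, by omega⟩ with hv₀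
  set v₁ := v ⟨1, by omega⟩ with hv₁
  set v₂ := v ⟨2, by omega⟩ with hv₂
  have hsign : Real.sign (det3 v₀ v₁ v₂) = 1 := by
    rw [← hnorm]
    exact hv _ _ _ (by simp) (by simp) (by simp)
  have hpos : 0 < det3 v₀ v₁ v₂ := by
    rw [← Real.sign_one, sign_eq_sign_iff_mul_pos one_ne_zero, one_mul] at hsign
    exact hsign
  set D := det3 v₀ v₁ v₂ with hD
  have hD0 : det3 v₀ v₁ v₂ ≠ 0 := hpos.ne'
  refine ⟨fun i => D⁻¹ • ![det3 (v i) v₁ v₂, det3 v₀ (v i) v₂, det3 v₀ v₁ (v i)], ?_, ?_, ?_, ?_⟩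
  · simp [← hv₀, ← hD, det3_self_left, det3_self_outer, hpos.ne']
  · simp [← hv₁, ← hD, det3_self_left, det3_self_right, hpos.ne']
  · simp [← hv₂, ← hD, det3_self_right, det3_self_outer, hpos.ne']
  · intro i j k hij hik hjk
    rw [det3_smul_smul_smul, det3_cofactors, ← hD, ← mul_assoc, sign_mul_of_pos (by positivity),
      hv i j k hij hik hjk]

theorem uniformChirotopeRealizationSpace_eq (hn : 3 ≤ n) {χ : Fin n → Fin n → Fin n → ℝ}
    {s : ℕ → ℕ → ℕ → ℝ}
    (hs : ∀ i j k : Fin n, i ≠ j → i ≠ k → j ≠ k → s i j k = χ i j k) :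
    uniformChirotopeRealizationSpace hn χ = signRealizationSpace s n := by
  ext W
  have hsingle : (Pi.single 0 1 : Fin 3 → ℝ) = ![1, 0, 0] ∧
      (Pi.single 1 1 : Fin 3 → ℝ) = ![0, 1, 0] ∧ (Pi.single 2 1 : Fin 3 → ℝ) = ![0, 0, 1] := by
    refine ⟨?_, ?_, ?_⟩ <;> ext a <;> fin_cases a <;> rfl
  have hbasis : (∀ (i : Fin n) (a : Fin 3), (i : ℕ) = a → W i = Pi.single a 1) ↔
      W ⟨0, by omega⟩ = ![1, 0, 0] ∧ W ⟨1, by omega⟩ = ![0, 1, 0] ∧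
        W ⟨2, by omega⟩ = ![0, 0, 1] := by
    rw [← hsingle.1, ← hsingle.2.1, ← hsingle.2.2]
    refine ⟨fun h => ⟨h _ 0 rfl, h _ 1 rfl, h _ 2 rfl⟩, fun ⟨h0, h1, h2⟩ i a hi => ?_⟩
    rw [show i = ⟨a, by omega⟩ from Fin.ext hi]
    fin_cases a
    exacts [h0, h1, h2]
  have hreal : IsRealizationOfUniform χ W ↔ ∀ i j k : Fin n, i ≠ j → i ≠ k → j ≠ k →
      Real.sign (det3 (W i) (W j) (W k)) = s i j k := by
    unfold IsRealizationOfUniform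
    refine forall_congr' fun i => forall_congr' fun j => forall_congr' fun k =>
      forall_congr' fun hij => forall_congr' fun hik => forall_congr' fun hjk => ?_
    rw [hs i j k hij hik hjk]
  simp only [uniformChirotopeRealizationSpace, signRealizationSpace, Set.mem_ofPred_eq, hbasis,
    hreal, and_assoc]

theorem stablyEquivalent_signRealizationSpace (hn : 3 ≤ n) {W₀ : ℕ → Fin 3 → ℝ}
    (h : IsDoublingSign n (detSign W₀)) {m : ℕ} (hm : n ≤ m) (hm' : m ≤ 2 * n) :
    StablyEquivalent ⟨3 * n, flat (signRealizationSpace (detSign W₀) n)⟩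
      ⟨3 * m, flat (signRealizationSpace (detSign W₀) m)⟩ := by
  induction m, hm using Nat.le_induction with
  | base => exact .refl _
  | succ m hm ih => exact .trans _ _ _ (ih (by omega)) (.rel _ _ (Or.inl ⟨3, _, rfl,
      isStableProjection_signRealizationSpace hn h hm (by omega)⟩))

theorem stablyEquivalent_polytopeRealizationSpace {d : ℕ} (hn : 3 ≤ n) (hN : d + 4 = 2 * n)
    {s : ℕ → ℕ → ℕ → ℝ} (hs : IsDoublingSign n s) {v : Fin (d + 4) → Fin d → ℝ} (hv : IsStandard v)
    (hvs : galeDual v ∈ signRealizationSpace s (d + 4)) :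
    StablyEquivalent ⟨3 * (d + 4), flat (signRealizationSpace s (d + 4))⟩
      ⟨d * (d + 4), flat (polytopeRealizationSpace v (basisIdx d))⟩ := by
  refine .trans _ _ _ (.rel _ _ (Or.inl ⟨d + 4, _, rfl, isStableProjection_weightSpace _
    (fun (a : Fin 3) i => MvPolynomial.X (flatIdx i a)) fun x hx => ?_⟩))
    (.trans _ ⟨d * (d + 4) + (d + 4), _⟩ _ (.rel _ _ (Or.inr (rationallyEquivalent_galeDual s
      (mem_polytopeRealizationSpace_iff_mem_signRealizationSpace hn hN hs hv hvs))))
    (.symm _ _ (.rel _ _ (Or.inl ⟨d + 4, _, rfl, isStableProjection_weightSpace _ _ fun _ _ =>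
      ⟨1, fun a => a.elim0, fun _ => one_pos⟩⟩))))
  obtain ⟨w, hw, hsum⟩ := hs.exists_weights hn hN (mem_flat.mp hx)
  refine ⟨w, fun a => ?_, hw⟩
  simp only [MvPolynomial.eval_X]
  exact hsum a

end Normalization

/-- **Lemma 2.3**: for every realizable uniform rank-3 chirotope on `n ≥ 3` elements there is
a neighborly polytope of dimension `2n − 4` with exactly `2n` vertices whose realization space
is stably equivalent to that of the chirotope. -/
theorem uniform_chirotope_to_neighborly_polytope (n : ℕ) (hn : 3 ≤ n)
    (χ : Fin n → Fin n → Fin n → ℝ) (hχ : IsRealizableUniformChirotope χ)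
    (hnorm : χ ⟨0, by omega⟩ ⟨1, by omega⟩ ⟨2, by omega⟩ = 1) :
    ∃ (v : Fin (2 * n) → Fin (2 * n - 4) → ℝ) (B : Finset (Fin (2 * n))),
      IsPolytopeVertexList v ∧
      IsNeighborly v ∧
      B.card = (2 * n - 4) + 1 ∧
      AffineIndependent ℝ (fun i : ↥B => v i) ∧
      StablyEquivalent ⟨3 * n, flat (uniformChirotopeRealizationSpace hn χ)⟩
        ⟨(2 * n - 4) * (2 * n), flat (polytopeRealizationSpace v B)⟩ := by
  obtain ⟨v, hv⟩ := uniformChirotopeRealizationSpace_nonempty hn hχ hnorm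
  obtain ⟨W, hWv, hs⟩ := exists_isDoublingSign hn (fun i => if h : i < n then v ⟨i, h⟩ else 0)
    (fun a b c ha hb hc hab hac hbc h0 => by
      simp only [ha, hb, hc, dif_pos] at h0
      have h1 := hv.2.2.2 ⟨a, ha⟩ ⟨b, hb⟩ ⟨c, hc⟩ (by simpa using hab) (by simpa using hac)
        (by simpa using hbc)
      rw [h0, Real.sign_zero] at h1
      rcases hχ.2.1 ⟨a, ha⟩ ⟨b, hb⟩ ⟨c, hc⟩ (by simpa using hab) (by simpa using hac)
        (by simpa using hbc) with h2 | h2 <;> rw [h2] at h1 <;> norm_num at h1)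
  have hWv' : ∀ i : Fin n, W i = v i := fun i => by simp [hWv]
  have hspace := uniformChirotopeRealizationSpace_eq hn (s := detSign W) (χ := χ)
    fun i j k hij hik hjk => by
      rw [detSign, hWv', hWv', hWv']
      exact hv.2.2.2 i j k hij hik hjk
  rw [hspace] at hv ⊢
  suffices key : ∀ N d, d + 4 = N → N = 2 * n →
      ∃ (v : Fin N → Fin d → ℝ) (B : Finset (Fin N)),
        IsPolytopeVertexList v ∧ IsNeighborly v ∧ B.card = d + 1 ∧
        AffineIndependent ℝ (fun i : ↥B => v i) ∧
        StablyEquivalent ⟨3 * n, flat (signRealizationSpace (detSign W) n)⟩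
          ⟨d * N, flat (polytopeRealizationSpace v B)⟩ from
    key (2 * n) (2 * n - 4) (by omega) rfl
  rintro _ d rfl hN
  have hmem : (fun i : Fin (d + 4) => W i) ∈ signRealizationSpace (detSign W) (d + 4) :=
    ⟨fun i a hi => (hWv' ⟨i, by omega⟩).trans (hv.1 _ a hi), fun _ _ _ _ _ _ => rfl⟩
  obtain ⟨w, hw, hsum⟩ := hs.exists_weights hn hN hmem
  have hst := isStandard_galePoints (fun i : Fin (d + 4) => W i) w
  have hgale := galeDual_galePoints_mem hmem hw hsum
  have hB := hs.isBalancedConfiguration hn hN hgale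
  have hsing := hB.hasPositiveDependency_compl_singleton hn hN
  have hinj := injective_of_hasPositiveDependency hst hsing
  have hext := fun i => mem_extremePoints_of_hasPositiveDependency hst (hsing i)
  refine ⟨galePoints (fun i : Fin (d + 4) => W i) w, basisIdx d, ⟨hinj, hext, hst.affineSpan_eq_top⟩,
    fun S hS => ?_, card_basisIdx d, hst.affineIndependent, .trans _ _ _
      (stablyEquivalent_signRealizationSpace hn hs (by omega) hN.le)
      (stablyEquivalent_polytopeRealizationSpace hn hN hs hst hgale)⟩
  rw [isVertexSetOfFace_iff_hasPositiveDependency hst hinj hext]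
  refine hB.hasPositiveDependency (hs.isUniformConfiguration hn hN hgale) (by simp [hN]) ?_
  rw [compl_compl]
  omega
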